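/- arXiv:2605.28263 — 4 statements merged into one kernel-verified Lean document; each statement's English description precedes it below -/
import Mathlib

section
/- For every δ > 0 and every function G : Δ(X) → ℝ that is continuous, strictly convex (G(t·μ + (1−t)·ν) < t·G(μ) + (1−t)·G(ν) whenever μ ≠ ν and t ∈ (0,1)), and invariant under allocation swaps (G(p_{i↔j}) = G(p) for all p and all i,j), there exists a weight vector λ̄ ∈ ℝ^N with λ̄_j ≥ 0 and Σ_j λ̄_j = 1 such that the unique maximizer p of Q(q) = Σ_{j=1}^N λ̄_j U_j(q) − δ·G(q) over Δ(X) is envy-free, i.e., U_j(p^j) ≥ U_j(p^k) for all j,k. -/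
open MeasureTheory
open scoped NNReal

/-- The `j`-th marginal of a probability measure on `X ⊆ Y^N`: the pushforward under the
`j`-th coordinate projection. -/
noncomputable def marginal {Y : Type*} [MeasurableSpace Y] {N : ℕ} {X : Set (Fin N → Y)}
    (p : ProbabilityMeasure ↥X) (j : Fin N) : ProbabilityMeasure Y :=
  p.map (f := fun x => (x : Fin N → Y) j)
    (((measurable_pi_apply j).comp measurable_subtype_coe).aemeasurable)

/-- The allocation swap `p_{i↔j}`: the pushforward of `p` under the coordinate-swap map
`T_{i↔j}` (which maps `X` into `X` by permutation invariance). -/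
noncomputable def swapAlloc {Y : Type*} [MeasurableSpace Y] {N : ℕ} {X : Set (Fin N → Y)}
    (hXswap : ∀ i j : Fin N, ∀ x ∈ X, x ∘ Equiv.swap i j ∈ X)
    (i j : Fin N) (p : ProbabilityMeasure ↥X) : ProbabilityMeasure ↥X :=
  p.map (f := fun x => (⟨(x : Fin N → Y) ∘ Equiv.swap i j, hXswap i j x x.2⟩ : ↥X))
    (Measurable.aemeasurable (by
      apply Measurable.subtype_mk
      apply measurable_pi_iff.mpr
      intro k
      exact (measurable_pi_apply _).comp measurable_subtype_coe))


set_option linter.unusedSectionVars false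

section Scarf
variable {W I : Type*} [Fintype W] [DecidableEq W] [Fintype I] [DecidableEq I]

def SDom (r : I → W → ℕ) (S : Finset W) : Prop :=
  ∀ y, ∃ i, ∀ x ∈ S, r i y ≤ r i x

theorem SDom.mono {r : I → W → ℕ} {S T : Finset W} (h : SDom r S) (hT : T ⊆ S) : SDom r T :=
  fun y => (h y).imp fun _ hi x hx => hi x (hT hx)

/-- `i` is redundant for `τ`. -/
def SRed (r : I → W → ℕ) (τ : Finset W) (i : I) : Prop :=
  ∀ x ∈ τ, ∃ k, k ≠ i ∧ ∀ x' ∈ τ, r k x ≤ r k x'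

def SM (r : I → W → ℕ) (τ : Finset W) (i : I) (y : W) : Prop :=
  ∀ k, k ≠ i → ∃ x ∈ τ, r k x < r k y

theorem scarf_pair (r : I → W → ℕ) (hr : ∀ i, Function.Injective (r i)) (τ : Finset W)
    (hne : τ.Nonempty) (hcard : τ.card + 1 = Fintype.card I) (hd : SDom r τ) :
    ∃ a b, a ≠ b ∧ ∀ i, SRed r τ i ↔ i = a ∨ i = b := by
  have hmin : ∀ i, ∃ x ∈ τ, ∀ x' ∈ τ, r i x ≤ r i x' := fun i => τ.exists_min_image (r i) hne
  choose m hm hm' using hmin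
  have hmu : ∀ i x, x ∈ τ → (∀ x' ∈ τ, r i x ≤ r i x') → m i = x := fun i x hx h =>
    hr i (le_antisymm (hm' i x hx) (h _ (hm i)))
  have hred : ∀ i, SRed r τ i ↔ ∀ x ∈ τ, ∃ k, k ≠ i ∧ m k = x := by
    intro i
    refine forall₂_congr fun x hx => exists_congr fun k => and_congr_right fun _ => ?_
    exact ⟨hmu k x hx, fun h => h ▸ hm' k⟩
  have hsurj : ∀ x ∈ τ, ∃ k, m k = x := fun x hx => by
    obtain ⟨k, hk⟩ := hd x
    exact ⟨k, hmu k x hx hk⟩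
  obtain ⟨a, -, b, -, hab, hmab⟩ : ∃ a ∈ (Finset.univ : Finset I), ∃ b ∈ (Finset.univ : Finset I),
      a ≠ b ∧ m a = m b := by
    apply Finset.exists_ne_map_eq_of_card_lt_of_maps_to (t := τ)
    · rw [Finset.card_univ]; omega
    · intro i _; exact hm i
  have hE : (Finset.univ.erase a).image m = τ := by
    ext x
    simp only [Finset.mem_image, Finset.mem_erase, Finset.mem_univ, and_true]
    constructor
    · rintro ⟨k, -, rfl⟩; exact hm k
    · intro hx
      obtain ⟨k, rfl⟩ := hsurj x hx
      by_cases h : k = a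
      · exact ⟨b, hab.symm, by rw [h, hmab]⟩
      · exact ⟨k, h, rfl⟩
  have hinj : Set.InjOn m (Finset.univ.erase a : Finset I) := by
    apply Finset.injOn_of_card_image_eq
    rw [hE, Finset.card_erase_of_mem (Finset.mem_univ _), Finset.card_univ]; omega
  refine ⟨a, b, hab, fun i => ?_⟩
  rw [hred]
  constructor
  · intro h
    by_contra! hi
    obtain ⟨k, hk, hk'⟩ := h (m i) (hm i)
    by_cases hka : k = a
    · apply hi.2
      apply hinj (by simp [hi.1]) (by simp [hab.symm])
      rw [← hk', hka, hmab]
    · exact hk (hinj (by simp [hka]) (by simp [hi.1]) hk')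
  · rintro h x hx
    obtain ⟨k, rfl⟩ := hsurj x hx
    by_cases hk : k = i
    · subst hk
      rcases h with rfl | rfl
      · exact ⟨b, hab.symm, hmab.symm⟩
      · exact ⟨a, hab, hmab⟩
    · exact ⟨k, hk, rfl⟩

theorem scarf_insert (r : I → W → ℕ) (hr : ∀ i, Function.Injective (r i)) (τ : Finset W)
    (hcard : τ.card + 1 = Fintype.card I) (hd : SDom r τ) (y : W) :
    (y ∉ τ ∧ SDom r (insert y τ)) ↔
      ∃ i, SRed r τ i ∧ SM r τ i y ∧ ∀ z, SM r τ i z → r i z ≤ r i y := by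
  constructor
  · rintro ⟨hy, h⟩
    -- the argmin map on insert y τ is a bijection
    have hsel : ∀ x : (insert y τ : Finset W), ∃ i, ∀ x' ∈ insert y τ, r i x ≤ r i x' := fun x => h x
    choose g hg using hsel
    have hginj : Function.Injective g := by
      intro x x' hxx
      apply Subtype.ext
      apply hr (g x)
      refine le_antisymm (hg x _ x'.2) ?_
      rw [hxx]; exact hg x' _ x.2
    have hgb : Function.Bijective g := by
      rw [Fintype.bijective_iff_injective_and_card]
      refine ⟨hginj, ?_⟩
      rw [Fintype.card_coe, Finset.card_insert_of_notMem hy, hcard]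
    set i := g ⟨y, Finset.mem_insert_self _ _⟩ with hi
    have hM : SM r τ i y := by
      intro k hk
      obtain ⟨x, rfl⟩ := hgb.2 k
      have hxy : (x : W) ≠ y := by
        intro hxy
        apply hk
        rw [hi]; congr 1; exact Subtype.ext hxy
      have hxτ : (x : W) ∈ τ := by
        have := x.2
        rw [Finset.mem_insert] at this
        exact this.resolve_left hxy
      refine ⟨x, hxτ, lt_of_le_of_ne (hg x y (Finset.mem_insert_self _ _)) fun h => hxy (hr _ h)⟩
    refine ⟨i, ?_, hM, ?_⟩
    · intro x hx
      refine ⟨g ⟨x, Finset.mem_insert_of_mem hx⟩, ?_, fun x' hx' => hg _ x' (Finset.mem_insert_of_mem hx')⟩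
      intro h
      have := hginj h
      simp only [Subtype.mk.injEq] at this
      exact hy (this ▸ hx)
    · intro z hz
      obtain ⟨k, hk⟩ := h z
      by_cases hki : k = i
      · subst hki; exact hk y (Finset.mem_insert_self _ _)
      · obtain ⟨x, hx, hlt⟩ := hz k hki
        exact absurd (hk x (Finset.mem_insert_of_mem hx)) (not_le.2 hlt)
  · rintro ⟨i, hred, hM, hmax⟩
    have hy : y ∉ τ := by
      intro hy
      obtain ⟨k, hk, hk'⟩ := hred y hy
      obtain ⟨x, hx, hlt⟩ := hM k hk
      exact absurd (hk' x hx) (not_le.2 hlt)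
    refine ⟨hy, ?_⟩
    intro z
    by_contra! hz
    -- y ≤ τ in coordinate i
    have hyi : ∀ x ∈ τ, r i y ≤ r i x := by
      obtain ⟨k, hk⟩ := hd y
      by_cases hki : k = i
      · subst hki; exact hk
      · obtain ⟨x, hx, hlt⟩ := hM k hki
        exact absurd (hk x hx) (not_le.2 hlt)
    have hzM : SM r τ i z := by
      intro k hk
      obtain ⟨x, hx, hlt⟩ := hz k
      rw [Finset.mem_insert] at hx
      rcases hx with rfl | hx
      · obtain ⟨x', hx', hlt'⟩ := hM k hk
        exact ⟨x', hx', hlt'.trans hlt⟩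
      · exact ⟨x, hx, hlt⟩
    obtain ⟨x, hx, hlt⟩ := hz i
    have h1 := hmax z hzM
    rw [Finset.mem_insert] at hx
    rcases hx with rfl | hx
    · omega
    · have := hyi x hx; omega

open Classical in
theorem scarf_argmax (r : I → W → ℕ) (hr : ∀ i, Function.Injective (r i)) (τ : Finset W) (i : I) :
    (Finset.univ.filter fun y => SM r τ i y ∧ ∀ z, SM r τ i z → r i z ≤ r i y).card
      = if ∃ y, SM r τ i y then 1 else 0 := by
  split_ifs with h
  · obtain ⟨y0, hy0⟩ := h
    obtain ⟨y, hy, hmax⟩ := (Finset.univ.filter fun y => SM r τ i y).exists_max_image (r i)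
      ⟨y0, by simpa using hy0⟩
    rw [Finset.card_eq_one]
    refine ⟨y, ?_⟩
    ext z
    simp only [Finset.mem_filter, Finset.mem_univ, true_and, Finset.mem_singleton] at hy hmax ⊢
    constructor
    · rintro ⟨h1, h2⟩
      exact hr i (le_antisymm (hmax z h1) (h2 y hy))
    · rintro rfl; exact ⟨hy, hmax⟩
  · rw [Finset.card_eq_zero, Finset.filter_eq_empty_iff]
    rintro y - ⟨hy, -⟩
    exact h ⟨y, hy⟩

open Classical in
theorem scarf_door (r : I → W → ℕ) (hr : ∀ i, Function.Injective (r i)) (τ : Finset W)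
    (hcard : τ.card + 1 = Fintype.card I) (hd : SDom r τ)
    (a b : I) (hab : a ≠ b) (hred : ∀ i, SRed r τ i ↔ i = a ∨ i = b) :
    (Finset.univ.filter fun S : Finset W =>
        (SDom r S ∧ S.card = Fintype.card I) ∧ τ ⊆ S).card
      = (if ∃ y, SM r τ a y then 1 else 0) + (if ∃ y, SM r τ b y then 1 else 0) := by
  have h1 : (Finset.univ.filter fun S : Finset W =>
        (SDom r S ∧ S.card = Fintype.card I) ∧ τ ⊆ S)
      = (Finset.univ.filter fun y => y ∉ τ ∧ SDom r (insert y τ)).image (fun y => insert y τ) := by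
    ext S
    simp only [Finset.mem_filter, Finset.mem_univ, true_and, Finset.mem_image]
    constructor
    · rintro ⟨⟨hS, hSc⟩, hτ⟩
      have : (S \ τ).card = 1 := by
        rw [Finset.card_sdiff_of_subset hτ]; omega
      obtain ⟨y, hy⟩ := Finset.card_eq_one.1 this
      have hyS : y ∈ S \ τ := by rw [hy]; simp
      have hins : insert y τ = S := by
        rw [Finset.insert_eq, ← hy, Finset.sdiff_union_of_subset hτ]
      exact ⟨y, ⟨(Finset.mem_sdiff.1 hyS).2, hins ▸ hS⟩, hins⟩
    · rintro ⟨y, ⟨hy, hS⟩, rfl⟩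
      exact ⟨⟨hS, by rw [Finset.card_insert_of_notMem hy, hcard]⟩, Finset.subset_insert _ _⟩
  rw [h1, Finset.card_image_of_injOn, ← scarf_argmax r hr, ← scarf_argmax r hr,
    ← Finset.card_union_of_disjoint]
  · congr 1
    ext y
    simp only [Finset.mem_filter, Finset.mem_univ, true_and, Finset.mem_union]
    rw [scarf_insert r hr τ hcard hd]
    constructor
    · rintro ⟨i, hi, h⟩
      rcases (hred i).1 hi with rfl | rfl
      · exact Or.inl h
      · exact Or.inr h
    · rintro (h | h)
      · exact ⟨a, (hred a).2 (Or.inl rfl), h⟩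
      · exact ⟨b, (hred b).2 (Or.inr rfl), h⟩
  · rw [Finset.disjoint_left]
    intro y hy hy'
    simp only [Finset.mem_filter, Finset.mem_univ, true_and] at hy hy'
    obtain ⟨k, hk⟩ := hd y
    by_cases hka : k = a
    · obtain ⟨x, hx, hlt⟩ := hy'.1 k (hka ▸ hab)
      exact absurd (hk x hx) (not_le.2 hlt)
    · obtain ⟨x, hx, hlt⟩ := hy.1 k hka
      exact absurd (hk x hx) (not_le.2 hlt)
  · intro y hy y' hy' h
    simp only [Finset.coe_filter, Finset.mem_univ, true_and, Set.mem_ofPred_eq] at hy hy'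
    have : y ∈ insert y' τ := by
      have h' : insert y τ = insert y' τ := h
      rw [← h']; exact Finset.mem_insert_self _ _
    exact (Finset.mem_insert.1 this).resolve_right hy.1

open Classical in
theorem scarf_room (c : W → I) (i0 : I) (S : Finset W) (hS : S.card = Fintype.card I)
    (hc : S.image c ≠ Finset.univ) :
    Even (Finset.univ.filter fun τ : Finset W =>
      (τ.card + 1 = Fintype.card I ∧ τ.image c = Finset.univ.erase i0) ∧ τ ⊆ S).card := by
  by_cases h : ∃ τ : Finset W, 
      (τ.card + 1 = Fintype.card I ∧ τ.image c = Finset.univ.erase i0) ∧ τ ⊆ S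
  swap
  · rw [Finset.filter_eq_empty_iff.2]
    · simp
    · intro τ _ hτ; exact h ⟨τ, hτ⟩
  obtain ⟨τ, ⟨hτc, hτi⟩, hτS⟩ := h
  have : (S \ τ).card = 1 := by
    rw [Finset.card_sdiff_of_subset hτS]; omega
  obtain ⟨x, hx⟩ := Finset.card_eq_one.1 this
  have hxS : x ∈ S \ τ := by rw [hx]; simp
  have hins : insert x τ = S := by
    rw [Finset.insert_eq, ← hx, Finset.sdiff_union_of_subset hτS]
  have hxτ := (Finset.mem_sdiff.1 hxS).2
  have hcx : c x ≠ i0 := by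
    intro h
    apply hc
    rw [← hins, Finset.image_insert, hτi, h, Finset.insert_erase (Finset.mem_univ _)]
  have : c x ∈ τ.image c := by rw [hτi]; simp [hcx]
  obtain ⟨x', hx'τ, hcx'⟩ := Finset.mem_image.1 this
  have hne : x ≠ x' := fun h => hxτ (h ▸ hx'τ)
  have hSx : S.erase x = τ := by rw [← hins, Finset.erase_insert hxτ]
  have hx'S := hτS hx'τ
  have hxS' := (Finset.mem_sdiff.1 hxS).1
  have hinj : Set.InjOn c τ := by
    apply Finset.injOn_of_card_image_eq
    rw [hτi, Finset.card_erase_of_mem (Finset.mem_univ _), Finset.card_univ]; omega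
  have himg : (S.erase x').image c = Finset.univ.erase i0 := by
    rw [← hτi]
    ext j
    simp only [Finset.mem_image]
    constructor
    · rintro ⟨z, hz, rfl⟩
      rw [Finset.mem_erase, ← hins, Finset.mem_insert] at hz
      rcases hz.2 with rfl | h
      · exact ⟨x', hx'τ, hcx'⟩
      · exact ⟨z, h, rfl⟩
    · rintro ⟨z, hz, rfl⟩
      by_cases hzx : z = x'
      · exact ⟨x, Finset.mem_erase.2 ⟨hne, hxS'⟩, by rw [hzx, hcx']⟩
      · exact ⟨z, Finset.mem_erase.2 ⟨hzx, hτS hz⟩, rfl⟩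
  have : (Finset.univ.filter fun τ : Finset W =>
      (τ.card + 1 = Fintype.card I ∧ τ.image c = Finset.univ.erase i0) ∧ τ ⊆ S)
      = {S.erase x, S.erase x'} := by
    ext ρ
    simp only [Finset.mem_filter, Finset.mem_univ, true_and, Finset.mem_insert,
      Finset.mem_singleton]
    constructor
    · rintro ⟨⟨h1, h2⟩, h3⟩
      by_contra! hcon
      have key : ∀ z ∈ S, z ∉ ρ → ρ = S.erase z := by
        intro z hz hzρ
        apply Finset.eq_of_subset_of_card_le
        · intro u hu
          exact Finset.mem_erase.2 ⟨fun h => hzρ (h ▸ hu), h3 hu⟩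
        · rw [Finset.card_erase_of_mem hz]; omega
      have e1 : x ∈ ρ := by by_contra h; exact hcon.1 (key x hxS' h)
      have e2 : x' ∈ ρ := by by_contra h; exact hcon.2 (key x' hx'S h)
      have hinj' : Set.InjOn c ρ := by
        apply Finset.injOn_of_card_image_eq
        rw [h2, Finset.card_erase_of_mem (Finset.mem_univ _), Finset.card_univ]; omega
      exact hne (hinj' e1 e2 hcx'.symm)
    · rintro (rfl | rfl)
      · rw [hSx]; exact ⟨⟨hτc, hτi⟩, hτS⟩
      · refine ⟨⟨?_, himg⟩, Finset.erase_subset _ _⟩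
        have : 0 < S.card := Finset.card_pos.2 ⟨_, hx'S⟩
        rw [Finset.card_erase_of_mem hx'S]; omega
  rw [this, Finset.card_pair]
  · exact even_two
  · intro h
    have : x ∈ S.erase x' := Finset.mem_erase.2 ⟨hne, hxS'⟩
    rw [← h] at this
    simp at this

open Classical in
/-- Scarf's lemma for `W = T ⊕ I`. -/
theorem scarf_main {T I : Type*} [Fintype T] [Fintype I] [Nonempty T]
    (hI : 2 ≤ Fintype.card I)
    (r : I → T ⊕ I → ℕ) (hr : ∀ i, Function.Injective (r i))
    (h0 : ∀ i, r i (Sum.inr i) = 0)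
    (hbig : ∀ i j x, i ≠ j → r i (Sum.inl x) < r i (Sum.inr j))
    (c : T ⊕ I → I) (hc : ∀ i, c (Sum.inr i) = i) :
    ∃ S : Finset (T ⊕ I), SDom r S ∧ ∀ i, ∃ w ∈ S, c w = i := by
  suffices h : ∃ S : Finset (T ⊕ I), SDom r S ∧ S.image c = Finset.univ by
    obtain ⟨S, hS, hc⟩ := h
    refine ⟨S, hS, fun i => Finset.mem_image.1 ?_⟩
    rw [hc]; exact Finset.mem_univ i
  by_contra! hcon
  obtain ⟨i0⟩ : Nonempty I := by
    rw [← Fintype.card_pos_iff]; omega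
  set doors : Finset (Finset (T ⊕ I)) := Finset.univ.filter fun τ =>
    SDom r τ ∧ τ.card + 1 = Fintype.card I ∧ τ.image c = Finset.univ.erase i0 with hdoors
  set rooms : Finset (Finset (T ⊕ I)) := Finset.univ.filter fun S =>
    SDom r S ∧ S.card = Fintype.card I with hrooms
  have hdc := Finset.sum_card_bipartiteAbove_eq_sum_card_bipartiteBelow
    (s := doors) (t := rooms) (fun τ S => τ ⊆ S)
  have hpos : ∀ i x, 0 < r i (Sum.inl x) := by
    intro i x
    rw [Nat.pos_iff_ne_zero, ← h0 i]
    intro h; simpa using hr i h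
  have hpos' : ∀ i j, i ≠ j → 0 < r i (Sum.inr j) := by
    intro i j hij
    rw [Nat.pos_iff_ne_zero, ← h0 i]
    intro h; exact hij (by simpa using (hr i h).symm)
  have heven : Even (∑ S ∈ rooms, (doors.bipartiteBelow (fun τ S => τ ⊆ S) S).card) := by
    apply Finset.even_sum
    intro S hS
    simp only [hrooms, Finset.mem_filter, Finset.mem_univ, true_and] at hS
    have := scarf_room c i0 S hS.2 (hcon S hS.1)
    refine (congrArg (fun s : Finset (Finset (T ⊕ I)) => Even s.card) ?_).mpr this
    ext τ
    simp only [Finset.bipartiteBelow, hdoors, Finset.mem_filter, Finset.mem_univ, true_and]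
    constructor
    · rintro ⟨⟨-, h⟩, h'⟩; exact ⟨h, h'⟩
    · rintro ⟨h, h'⟩; exact ⟨⟨hS.1.mono h', h⟩, h'⟩
  set O : Finset (T ⊕ I) := (Finset.univ.erase i0).image Sum.inr with hO
  have hOcard : O.card + 1 = Fintype.card I := by
    rw [hO, Finset.card_image_of_injective _ Sum.inr_injective,
      Finset.card_erase_of_mem (Finset.mem_univ _), Finset.card_univ]; omega
  have hOmem : ∀ j, Sum.inr j ∈ O ↔ j ≠ i0 := by intro j; simp [hO]
  have hOmem' : ∀ x ∈ O, ∃ j, j ≠ i0 ∧ x = Sum.inr j := by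
    intro x hx
    simp only [hO, Finset.mem_image, Finset.mem_erase, Finset.mem_univ, and_true] at hx
    obtain ⟨j, hj, rfl⟩ := hx
    exact ⟨j, hj, rfl⟩
  have hOdom : SDom r O := by
    intro y
    rcases y with y | j
    · refine ⟨i0, fun x hx => ?_⟩
      obtain ⟨j, hj, rfl⟩ := hOmem' x hx
      exact (hbig i0 j y hj.symm).le
    · refine ⟨j, fun x _ => ?_⟩
      rw [h0]; omega
  have hOdoor : O ∈ doors := by
    simp only [hdoors, Finset.mem_filter, Finset.mem_univ, true_and]
    refine ⟨hOdom, hOcard, ?_⟩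
    rw [hO, Finset.image_image]
    ext j
    simp [hc]
  have hfib : ∀ τ ∈ doors, (rooms.bipartiteAbove (fun τ S => τ ⊆ S) τ).card
      = if τ = O then 1 else 2 := by
    intro τ hτ
    simp only [hdoors, Finset.mem_filter, Finset.mem_univ, true_and] at hτ
    obtain ⟨hd, hcard, himg⟩ := hτ
    have hne : τ.Nonempty := by rw [← Finset.card_pos]; omega
    obtain ⟨a, b, hab, hred⟩ := scarf_pair r hr τ hne hcard hd
    have hdoor := scarf_door r hr τ hcard hd a b hab hred
    have heq : rooms.bipartiteAbove (fun τ S => τ ⊆ S) τ = (Finset.univ.filter fun S =>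
        (SDom r S ∧ S.card = Fintype.card I) ∧ τ ⊆ S) := by
      ext S; simp [Finset.bipartiteAbove, hrooms]
    rw [heq, hdoor]
    by_cases hτO : τ = O
    · rw [if_pos hτO]
      subst hτO
      have hMi0 : ∃ y, SM r O i0 y := by
        obtain ⟨t⟩ := ‹Nonempty T›
        refine ⟨Sum.inl t, fun k hk => ⟨Sum.inr k, (hOmem k).2 hk, ?_⟩⟩
        rw [h0]; exact hpos k t
      have hMb : ∀ b, b ≠ i0 → SRed r O b → ¬ ∃ y, SM r O b y := by
        rintro b hb hbr ⟨y, hy⟩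
        obtain ⟨k, hkb, hk⟩ := hbr (Sum.inr b) ((hOmem b).2 hb)
        have hk0 : k = i0 := by
          by_contra hk0
          have h1 := hk (Sum.inr k) ((hOmem k).2 hk0)
          have h2 := hpos' k b hkb
          rw [h0] at h1; omega
        subst hk0
        obtain ⟨x, hx, hlt⟩ := hy k hkb
        obtain ⟨j, hj, rfl⟩ := hOmem' x hx
        rcases y with y | l
        · have := hbig k j y hj.symm; omega
        · by_cases hlb : l = b
          · subst hlb
            have := hk _ hx; omega
          · obtain ⟨x', hx', hlt'⟩ := hy l hlb
            rw [h0] at hlt'; omega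
      have hred0 : SRed r O i0 := by
        intro x hx
        obtain ⟨j, hj, rfl⟩ := hOmem' x hx
        exact ⟨j, hj, fun x' _ => by rw [h0]; omega⟩
      rcases (hred i0).1 hred0 with h | h
      · subst h
        rw [if_pos hMi0, if_neg (hMb b hab.symm ((hred b).2 (Or.inr rfl)))]
      · subst h
        rw [if_pos hMi0, if_neg (hMb a hab ((hred a).2 (Or.inl rfl)))]
    · rw [if_neg hτO]
      obtain ⟨x0, hx0⟩ : ∃ x0, Sum.inl x0 ∈ τ := by
        by_contra! hno
        apply hτO
        apply Finset.eq_of_subset_of_card_le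
        · intro x hx
          rcases x with x | j
          · exact absurd hx (hno x)
          · rw [hOmem]
            have : c (Sum.inr j) ∈ τ.image c := Finset.mem_image_of_mem _ hx
            rw [himg, hc] at this
            exact Finset.ne_of_mem_erase this
        · omega
      have hM : ∀ i, ∃ y, SM r τ i y := fun i =>
        ⟨Sum.inr i, fun k hk => ⟨Sum.inl x0, hx0, hbig k i x0 hk⟩⟩
      rw [if_pos (hM a), if_pos (hM b)]
  rw [Finset.sum_congr rfl hfib] at hdc
  rw [← hdc, ← Finset.add_sum_erase _ _ hOdoor, if_pos rfl, Finset.sum_congr rfl (g := fun _ => 2)] at heven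
  · simp [parity_simps] at heven
  · intro τ hτ
    rw [if_neg (Finset.ne_of_mem_erase hτ)]

end Scarf

abbrev SGrid (N n : ℕ) := {x : Fin N → Fin (n + 1) // ∑ k, (x k : ℕ) = n}

theorem grid_lemma (N n : ℕ) (hN : 2 ≤ N) (c : SGrid N n → Fin N) :
    ∃ (C : Finset (Fin N)) (x : Fin N → SGrid N n), C.Nonempty ∧ (∀ i ∈ C, c (x i) = i) ∧
      (∀ i ∈ C, ∀ j ∈ C, ∀ k, ((x i).1 k : ℕ) ≤ (x j).1 k + N) ∧
      (∀ i ∈ C, ∀ k, k ∉ C → ((x i).1 k : ℕ) ≤ N) := by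
  classical
  have mk : ∀ y : Fin N → ℕ, ∑ k, y k = n → ∃ x : SGrid N n, ∀ k, (x.1 k : ℕ) = y k := by
    intro y hy
    have hle : ∀ k, y k < n + 1 := fun k => by
      have := Finset.single_le_sum (f := y) (fun _ _ => Nat.zero_le _) (Finset.mem_univ k)
      omega
    exact ⟨⟨fun k => ⟨y k, hle k⟩, hy⟩, fun k => rfl⟩
  obtain ⟨g0, -⟩ := mk (fun k => if k = ⟨0, by omega⟩ then n else 0) (by simp)
  have : Nonempty (SGrid N n) := ⟨g0⟩
  set M := Fintype.card (SGrid N n) with hM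
  let idx : SGrid N n → ℕ := fun x => (Fintype.equivFin (SGrid N n) x : ℕ)
  have hidx : ∀ x, idx x < M := fun x => (Fintype.equivFin (SGrid N n) x).2
  have hidxinj : ∀ x y, idx x = idx y → x = y := fun x y h =>
    (Fintype.equivFin (SGrid N n)).injective (Fin.ext h)
  let r : Fin N → SGrid N n ⊕ Fin N → ℕ := fun i w => match w with
    | Sum.inl x => 1 + (idx x + M * (x.1 i : ℕ))
    | Sum.inr j => if j = i then 0 else 1 + M * (n + 1) + j
  have hlt : ∀ i x, idx x + M * (x.1 i : ℕ) < M * (n + 1) := by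
    intro i x
    have h1 : (x.1 i : ℕ) ≤ n := Nat.lt_succ_iff.1 (x.1 i).2
    have h2 := Nat.mul_le_mul_left M h1
    have h3 := hidx x
    rw [Nat.mul_add]; omega
  have hr : ∀ i, Function.Injective (r i) := by
    intro i w w' h
    rcases w with x | j <;> rcases w' with x' | j' <;> simp only [r] at h
    · have h' : idx x + M * (x.1 i : ℕ) = idx x' + M * (x'.1 i : ℕ) := by omega
      have h2 := congrArg (· % M) h'
      simp only [Nat.add_mul_mod_self_left] at h2
      rw [Nat.mod_eq_of_lt (hidx x), Nat.mod_eq_of_lt (hidx x')] at h2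
      rw [hidxinj _ _ h2]
    · have := hlt i x
      split_ifs at h <;> omega
    · have := hlt i x'
      split_ifs at h <;> omega
    · split_ifs at h with h1 h2 h2
      · rw [h1, h2]
      · omega
      · omega
      · congr 1; apply Fin.ext; omega
  obtain ⟨S, hS, hSc⟩ := scarf_main (T := SGrid N n) (I := Fin N) (by simpa using hN) r hr
    (by intro i; simp [r])
    (by
      intro i j x hij
      have := hlt i x
      simp only [r, if_neg hij.symm]; omega)
    (Sum.elim c id) (by intro i; rfl)
  have hmono : ∀ i (x y : SGrid N n), r i (Sum.inl x) ≤ r i (Sum.inl y) →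
      (x.1 i : ℕ) ≤ y.1 i := by
    intro i x y h
    simp only [r] at h
    by_contra! hcon
    have h1 := Nat.mul_le_mul_left M (Nat.succ_le_of_lt hcon)
    have h2 := hidx y
    rw [Nat.succ_eq_add_one, Nat.mul_add] at h1
    omega
  set C : Finset (Fin N) := Finset.univ.filter fun i => Sum.inr i ∉ S with hC
  have hmemC : ∀ i, i ∈ C ↔ Sum.inr i ∉ S := by intro i; simp [hC]
  set σ : Finset (SGrid N n) := Finset.univ.filter fun x => Sum.inl x ∈ S with hσ
  have hmemσ : ∀ x, x ∈ σ ↔ Sum.inl x ∈ S := by intro i; simp [hσ]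
  have hcol : ∀ i ∈ C, ∃ x ∈ σ, c x = i := by
    intro i hi
    obtain ⟨w, hw, hwi⟩ := hSc i
    rcases w with x | j
    · exact ⟨x, (hmemσ x).2 hw, hwi⟩
    · simp only [Sum.elim_inr, id] at hwi
      subst hwi
      exact absurd hw ((hmemC _).1 hi)
  have hdom : ∀ y : SGrid N n, ∃ i ∈ C, ∀ x ∈ σ, (y.1 i : ℕ) ≤ x.1 i := by
    intro y
    obtain ⟨i, hi⟩ := hS (Sum.inl y)
    refine ⟨i, ?_, fun x hx => hmono i y x (hi _ ((hmemσ x).1 hx))⟩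
    rw [hmemC]
    intro hiS
    have := hi _ hiS
    simp [r] at this
  obtain ⟨i1, hi1, -⟩ := hdom g0
  have hCne : C.Nonempty := ⟨i1, hi1⟩
  have hσne : σ.Nonempty := by
    obtain ⟨x, hx, -⟩ := hcol i1 hi1
    exact ⟨x, hx⟩
  have hm : ∀ k : Fin N, ∃ x ∈ σ, ∀ x' ∈ σ, (x.1 k : ℕ) ≤ x'.1 k := fun k =>
    σ.exists_min_image (fun x => (x.1 k : ℕ)) hσne
  choose mx hmx hmin using hm
  set m : Fin N → ℕ := fun k => ((mx k).1 k : ℕ) with hmdef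
  have hsum : n < ∑ k ∈ C, m k + N := by
    by_contra! hcon
    have hs : ∑ k ∈ C, (m k + 1) ≤ n := by
      rw [Finset.sum_add_distrib]
      have : C.card ≤ N := by simpa using Finset.card_le_univ C
      simp; omega
    obtain ⟨y, hy⟩ := mk (fun k => (if k ∈ C then m k + 1 else 0) +
      (if k = i1 then n - ∑ k ∈ C, (m k + 1) else 0)) (by
        rw [Finset.sum_add_distrib, Finset.sum_ite_mem, Finset.univ_inter,
          Finset.sum_ite_eq' ]
        simp only [Finset.mem_univ, if_true]
        omega)
    obtain ⟨i, hi, hle⟩ := hdom y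
    have h1 := hle _ (hmx i)
    rw [hy, if_pos hi] at h1
    simp only [hmdef] at h1
    omega
  have hb1 : ∀ x ∈ σ, ∀ k ∈ C, (x.1 k : ℕ) ≤ m k + N := by
    intro x hx k hk
    have h1 : ∑ j ∈ C, (x.1 j : ℕ) ≤ n := by
      conv_rhs => rw [← x.2]
      exact Finset.sum_le_sum_of_subset (Finset.subset_univ _)
    have h2 : ∑ j ∈ C.erase k, m j ≤ ∑ j ∈ C.erase k, (x.1 j : ℕ) :=
      Finset.sum_le_sum fun j _ => hmin j x hx
    rw [← Finset.add_sum_erase _ _ hk] at h1 hsum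
    omega
  have hb2 : ∀ x ∈ σ, ∀ k, k ∉ C → (x.1 k : ℕ) ≤ N := by
    intro x hx k hk
    have h1 : ∑ j ∈ insert k C, (x.1 j : ℕ) ≤ n := by
      conv_rhs => rw [← x.2]
      exact Finset.sum_le_sum_of_subset (Finset.subset_univ _)
    have h2 : ∑ j ∈ C, m j ≤ ∑ j ∈ C, (x.1 j : ℕ) :=
      Finset.sum_le_sum fun j _ => hmin j x hx
    rw [Finset.sum_insert hk] at h1
    omega
  have hx : ∀ i, ∃ x : SGrid N n, i ∈ C → x ∈ σ ∧ c x = i := by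
    intro i
    by_cases hi : i ∈ C
    · obtain ⟨x, hx⟩ := hcol i hi
      exact ⟨x, fun _ => hx⟩
    · exact ⟨g0, fun h => absurd h hi⟩
  choose x hx using hx
  refine ⟨C, x, hCne, fun i hi => (hx i hi).2, ?_, fun i hi => hb2 _ (hx i hi).1⟩
  intro i hi j hj k
  by_cases hk : k ∈ C
  · have h1 := hb1 _ (hx i hi).1 k hk
    have h2 := hmin k _ (hx j hj).1
    simp only [hmdef] at h1
    omega
  · have := hb2 _ (hx i hi).1 k hk
    omega

open Filter Topology in
theorem simplex_fixed (N : ℕ) (hN : 1 ≤ N) (d : stdSimplex ℝ (Fin N) → Fin N → ℝ)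
    (hd0 : ∀ z i, 0 ≤ d z i) (hd : ∀ i, Continuous fun z => d z i) :
    ∃ z : stdSimplex ℝ (Fin N), ∀ i, d z i = z.1 i * ∑ j, d z j := by
  classical
  have hcol : ∀ z : stdSimplex ℝ (Fin N), ∃ i, z.1 i * ∑ j, d z j ≤ d z i := by
    intro z
    by_contra! h
    have h1 : ∑ i, d z i < ∑ i, z.1 i * ∑ j, d z j :=
      Finset.sum_lt_sum_of_nonempty ⟨⟨0, by omega⟩, Finset.mem_univ _⟩ fun i _ => h i
    rw [← Finset.sum_mul, z.2.2, one_mul] at h1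
    exact lt_irrefl _ h1
  rcases Nat.lt_or_ge N 2 with h2 | h2
  · obtain rfl : N = 1 := by omega
    refine ⟨⟨fun _ => 1, fun _ => zero_le_one, by simp⟩, fun i => ?_⟩
    rw [Subsingleton.elim i 0]; simp
  choose col hcol using hcol
  let toS : (n : ℕ) → SGrid N (n + 1) → stdSimplex ℝ (Fin N) := fun n x =>
    ⟨fun k => ((x.1 k : ℕ) : ℝ) / ((n : ℝ) + 1), fun k => by positivity, by
      rw [← Finset.sum_div, ← Nat.cast_sum, x.2]
      push_cast
      exact div_self (by positivity)⟩
  have key := fun n => grid_lemma N (n + 1) h2 (fun x => col (toS n x))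
  choose C x hCne hcx hclose hzero using key
  let F : Ultrafilter ℕ := hyperfilter ℕ
  have hF : (F : Filter ℕ) ≤ atTop := by
    rw [← Nat.cofinite_eq_atTop]; exact hyperfilter_le_cofinite
  -- constant C
  obtain ⟨C0, hC0⟩ : ∃ C0, ∀ᶠ n in (F : Filter ℕ), C n = C0 := by
    have := (F.map C).eq_pure_of_finite
    obtain ⟨C0, h⟩ := this
    refine ⟨C0, ?_⟩
    have h' : ({C0} : Set (Finset (Fin N))) ∈ F.map C := by rw [h]; exact Ultrafilter.mem_pure.2 rfl
    exact h'
  obtain ⟨n0, hn0⟩ := hC0.exists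
  obtain ⟨i1, hi1⟩ : C0.Nonempty := hn0 ▸ hCne n0
  obtain ⟨z, -, hz⟩ := (isCompact_univ (X := stdSimplex ℝ (Fin N))).ultrafilter_le_nhds
    (F.map fun n => toS n (x n i1)) (by simp)
  have hz1 : Tendsto (fun n => toS n (x n i1)) F (𝓝 z) := hz
  have hzk : ∀ k, Tendsto (fun n => (toS n (x n i1)).1 k) F (𝓝 (z.1 k)) := fun k =>
    ((continuous_apply k).comp continuous_subtype_val).continuousAt.tendsto.comp hz1
  have hNn : Tendsto (fun n : ℕ => (N : ℝ) / ((n : ℝ) + 1)) F (𝓝 0) := by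
    refine Tendsto.mono_left ?_ hF
    exact tendsto_const_nhds.div_atTop
      (tendsto_atTop_add_const_right _ _ tendsto_natCast_atTop_atTop)
  have hzi : ∀ i ∈ C0, Tendsto (fun n => toS n (x n i)) F (𝓝 z) := by
    intro i hi
    rw [tendsto_subtype_rng, tendsto_pi_nhds]
    intro k
    have hdiff : Tendsto (fun n => (toS n (x n i)).1 k - (toS n (x n i1)).1 k) F (𝓝 0) := by
      apply squeeze_zero_norm' _ hNn
      filter_upwards [hC0] with n hn
      have a1 := hclose n i (hn ▸ hi) i1 (hn ▸ hi1) k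
      have a2 := hclose n i1 (hn ▸ hi1) i (hn ▸ hi) k
      have b1 : ((x n i).1 k : ℝ) ≤ ((x n i1).1 k : ℕ) + (N : ℝ) := by exact_mod_cast a1
      have b2 : ((x n i1).1 k : ℝ) ≤ ((x n i).1 k : ℕ) + (N : ℝ) := by exact_mod_cast a2
      simp only [toS, ← sub_div, Real.norm_eq_abs, abs_div]
      have : (0 : ℝ) < (n : ℝ) + 1 := by positivity
      rw [abs_of_pos this]
      gcongr
      rw [abs_le]; constructor <;> linarith
    have := hdiff.add (hzk k)
    simpa using this
  have hle : ∀ i, z.1 i * ∑ j, d z j ≤ d z i ∨ z.1 i = 0 := by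
    intro i
    by_cases hi : i ∈ C0
    · left
      have c1 : Continuous fun z : stdSimplex ℝ (Fin N) => d z i - z.1 i * ∑ j, d z j := by
        have e1 : Continuous fun z : stdSimplex ℝ (Fin N) => z.1 i :=
          (continuous_apply i).comp continuous_subtype_val
        exact (hd i).sub (e1.mul (continuous_finsetSum _ fun j _ => hd j))
      have c2 := (c1.tendsto z).comp (hzi i hi)
      have : 0 ≤ d z i - z.1 i * ∑ j, d z j := by
        apply ge_of_tendsto c2
        filter_upwards [hC0] with n hn
        have e1 := hcx n i (hn ▸ hi)
        have e2 := hcol (toS n (x n i))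
        rw [e1] at e2
        simp only [Function.comp]
        linarith
      linarith
    · right
      refine tendsto_nhds_unique (hzk i) ?_
      apply squeeze_zero_norm' _ hNn
      filter_upwards [hC0] with n hn
      have a1 := hzero n i1 (hn ▸ hi1) i (hn ▸ hi)
      have b1 : ((x n i1).1 i : ℝ) ≤ (N : ℝ) := by exact_mod_cast a1
      simp only [toS, Real.norm_eq_abs, abs_div]
      have : (0 : ℝ) < (n : ℝ) + 1 := by positivity
      rw [abs_of_pos this]
      gcongr
      rw [abs_le]; constructor <;> linarith [Nat.cast_nonneg (α := ℝ) ((x n i1).1 i : ℕ)]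
  have hle' : ∀ i ∈ Finset.univ, z.1 i * ∑ j, d z j ≤ d z i := by
    intro i _
    rcases hle i with h | h
    · exact h
    · rw [h, zero_mul]; exact hd0 z i
  have heq : ∑ i, z.1 i * ∑ j, d z j = ∑ i, d z i := by
    rw [← Finset.sum_mul, z.2.2, one_mul]
  exact ⟨z, fun i => ((Finset.sum_eq_sum_iff_of_le hle').1 heq i (Finset.mem_univ i)).symm⟩

theorem exists_noenvy (N : ℕ) (w : Fin N → ℝ) (hw : ∀ j, 0 ≤ w j) (hw1 : ∑ j, w j = 1)
    (E : Fin N → Fin N → ℝ)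
    (hopt : ∀ σ : Equiv.Perm (Fin N), ∑ j, w j * E j (σ j) ≤ ∑ j, w j * E j j) :
    ∃ j, 0 < w j ∧ ∀ k, E j k ≤ E j j := by
  classical
  by_contra! hcon
  obtain ⟨j0, hj0⟩ : ∃ j, 0 < w j := by
    by_contra! h
    have : ∑ j, w j ≤ 0 := Finset.sum_nonpos fun j _ => h j
    linarith
  have hf : ∀ j, ∃ k, (0 < w j → E j j < E j k) ∧ (¬ 0 < w j → k = j0) := by
    intro j
    by_cases h : 0 < w j
    · obtain ⟨k, hk⟩ := hcon j h
      exact ⟨k, fun _ => hk, fun h' => absurd h h'⟩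
    · exact ⟨j0, fun h' => absurd h' h, fun _ => rfl⟩
  choose f hf1 hf2 using hf
  have hbij := Function.bijOn_periodicPts f
  obtain ⟨x, hx⟩ : ∃ x, x ∈ Function.periodicPts f := by
    obtain ⟨m, n, hmn, h⟩ := Finite.exists_ne_map_eq_of_infinite (fun n : ℕ => f^[n] j0)
    wlog hlt : m < n generalizing m n
    · exact this n m hmn.symm h.symm (by omega)
    refine ⟨f^[m] j0, Function.mk_mem_periodicPts (n := n - m) (by omega) ?_⟩
    rw [Function.IsPeriodicPt, Function.IsFixedPt, ← Function.iterate_add_apply,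
      Nat.sub_add_cancel hlt.le, h]
  obtain ⟨y, hy, hwy⟩ : ∃ y ∈ Function.periodicPts f, 0 < w y := by
    by_cases h : 0 < w x
    · exact ⟨x, hx, h⟩
    · refine ⟨f x, hbij.mapsTo hx, ?_⟩
      rw [hf2 x h]; exact hj0
  let σ : Equiv.Perm (Fin N) := Equiv.Perm.ofSubtype (p := (· ∈ Function.periodicPts f)) hbij.equiv
  have hσ1 : ∀ j, j ∈ Function.periodicPts f → σ j = f j := by
    intro j hj
    exact Equiv.Perm.ofSubtype_apply_of_mem (p := (· ∈ Function.periodicPts f)) _ hj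
  have hσ2 : ∀ j, j ∉ Function.periodicPts f → σ j = j := by
    intro j hj
    exact Equiv.Perm.ofSubtype_apply_of_not_mem (p := (· ∈ Function.periodicPts f)) _ hj
  refine absurd (hopt σ) (not_le.2 ?_)
  apply Finset.sum_lt_sum
  · intro j _
    rcases (hw j).lt_or_eq with h | h
    · by_cases hj : j ∈ Function.periodicPts f
      · rw [hσ1 j hj]
        exact mul_le_mul_of_nonneg_left (hf1 j h).le h.le
      · rw [hσ2 j hj]
    · rw [← h]; simp
  · refine ⟨y, Finset.mem_univ _, ?_⟩
    rw [hσ1 y hy]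
    exact mul_lt_mul_of_pos_left (hf1 y hwy) hwy

theorem marginal_swapAlloc {Y : Type*} [MeasurableSpace Y] {N : ℕ} {X : Set (Fin N → Y)}
    (hXswap : ∀ i j : Fin N, ∀ x ∈ X, x ∘ Equiv.swap i j ∈ X)
    (i j : Fin N) (p : ProbabilityMeasure ↥X) (k : Fin N) :
    marginal (swapAlloc hXswap i j p) k = marginal p (Equiv.swap i j k) := by
  apply Subtype.ext
  change Measure.map _ (Measure.map _ _) = Measure.map _ _
  rw [Measure.map_map]
  · rfl
  · exact (measurable_pi_apply k).comp measurable_subtype_coe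
  · apply Measurable.subtype_mk
    apply measurable_pi_iff.mpr
    intro k
    exact (measurable_pi_apply _).comp measurable_subtype_coe

theorem exists_perm {Y : Type*} [MeasurableSpace Y] {N : ℕ} {X : Set (Fin N → Y)}
    (hXswap : ∀ i j : Fin N, ∀ x ∈ X, x ∘ Equiv.swap i j ∈ X)
    (G : ProbabilityMeasure ↥X → ℝ)
    (hGinv : ∀ (i j : Fin N) (p : ProbabilityMeasure ↥X), G (swapAlloc hXswap i j p) = G p)
    (p : ProbabilityMeasure ↥X) (σ : Equiv.Perm (Fin N)) :
    ∃ q : ProbabilityMeasure ↥X, G q = G p ∧ ∀ j, marginal q j = marginal p (σ j) := by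
  induction σ using Equiv.Perm.swap_induction_on' with
  | one => exact ⟨p, rfl, fun j => rfl⟩
  | mul_swap f x y _ ih =>
    obtain ⟨q, hq, hq'⟩ := ih
    refine ⟨swapAlloc hXswap x y q, by rw [hGinv, hq], fun j => ?_⟩
    rw [marginal_swapAlloc, hq']; rfl

theorem exists_mix {Ω : Type*} [MeasurableSpace Ω] (p q : ProbabilityMeasure Ω) :
    ∃ σ : ProbabilityMeasure Ω, (σ : Measure Ω) =
      (1 / 2 : ℝ≥0) • (p : Measure Ω) + (1 - 1 / 2 : ℝ≥0) • (q : Measure Ω) := by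
  refine ⟨⟨(1 / 2 : ℝ≥0) • (p : Measure Ω) + (1 - 1 / 2 : ℝ≥0) • (q : Measure Ω), ⟨?_⟩⟩, rfl⟩
  rw [Measure.add_apply, Measure.smul_apply, Measure.smul_apply, measure_univ, measure_univ]
  rw [← add_smul, add_tsub_cancel_of_le]
  · simp
  · rw [← NNReal.coe_le_coe]; push_cast; norm_num

theorem max_unique {Y : Type*} [MeasurableSpace Y]
    (N : ℕ) (X : Set (Fin N → Y))
    (U : Fin N → ProbabilityMeasure Y → ℝ)
    (hUconc : ∀ (j : Fin N) (μ ν σ : ProbabilityMeasure Y) (t : ℝ≥0), t ≤ 1 →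
      (σ : Measure Y) = t • (μ : Measure Y) + (1 - t) • (ν : Measure Y) →
      (t : ℝ) * U j μ + (1 - (t : ℝ)) * U j ν ≤ U j σ)
    (δ : ℝ) (hδ : 0 < δ)
    (G : ProbabilityMeasure ↥X → ℝ)
    (hGconv : ∀ (μ ν σ : ProbabilityMeasure ↥X) (t : ℝ≥0), 0 < t → t < 1 → μ ≠ ν →
      (σ : Measure ↥X) = t • (μ : Measure ↥X) + (1 - t) • (ν : Measure ↥X) →
      G σ < (t : ℝ) * G μ + (1 - (t : ℝ)) * G ν)
    (w : Fin N → ℝ) (hw : ∀ j, 0 ≤ w j) (p q : ProbabilityMeasure ↥X)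
    (hp : ∀ r : ProbabilityMeasure ↥X,
      ∑ j, w j * U j (marginal r j) - δ * G r ≤ ∑ j, w j * U j (marginal p j) - δ * G p)
    (hq : ∀ r : ProbabilityMeasure ↥X,
      ∑ j, w j * U j (marginal r j) - δ * G r ≤ ∑ j, w j * U j (marginal q j) - δ * G q) :
    q = p := by
  by_contra hne
  obtain ⟨σ, hσ⟩ := exists_mix p q
  have hlt : (1 / 2 : ℝ≥0) < 1 := by rw [← NNReal.coe_lt_coe]; push_cast; norm_num
  have h1 := hGconv p q σ (1 / 2) (by positivity) hlt (Ne.symm hne) hσ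
  have h2 : ∀ j, (1 / 2 : ℝ) * U j (marginal p j) + (1 / 2) * U j (marginal q j)
      ≤ U j (marginal σ j) := by
    intro j
    have := hUconc j (marginal p j) (marginal q j) (marginal σ j) (1 / 2) hlt.le (by
      have hm : Measurable fun x : X => (x : Fin N → Y) j :=
        (measurable_pi_apply j).comp measurable_subtype_coe
      change Measure.map _ _ = _ • Measure.map _ _ + _ • Measure.map _ _
      rw [hσ, Measure.map_add _ _ hm, Measure.map_smul, Measure.map_smul])
    push_cast at this
    linarith
  have h3 : ∑ j, ((1 / 2 : ℝ) * (w j * U j (marginal p j)) + (1 / 2) * (w j * U j (marginal q j)))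
      ≤ ∑ j, w j * U j (marginal σ j) := by
    apply Finset.sum_le_sum
    intro j _
    have := mul_le_mul_of_nonneg_left (h2 j) (hw j)
    linarith
  rw [Finset.sum_add_distrib, ← Finset.mul_sum, ← Finset.mul_sum] at h3
  have h4 := hp σ
  have h5 := hq σ
  push_cast at h1
  have h6 := mul_lt_mul_of_pos_left h1 hδ
  linarith

/-- In the general allocation setting (compact permutation-invariant
`X ⊆ Y^N`, continuous concave utilities `U_j : Δ(Y) → ℝ`), for every `δ > 0` and every
continuous, strictly convex, swap-invariant `G : Δ(X) → ℝ` there is a weight vector `w̄`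
in the simplex such that the unique maximizer `p` of
`Q(q) = ∑ j, w̄ j * U j (q^j) − δ G(q)` over `Δ(X)` is envy-free. -/
theorem stmt3 {Y : Type*} [TopologicalSpace Y] [TopologicalSpace.MetrizableSpace Y]
    [MeasurableSpace Y] [BorelSpace Y]
    (N : ℕ) (hN : 1 ≤ N) (X : Set (Fin N → Y)) (hXne : X.Nonempty) (hXcomp : IsCompact X)
    [OpensMeasurableSpace ↥X]
    (hXswap : ∀ i j : Fin N, ∀ x ∈ X, x ∘ Equiv.swap i j ∈ X)
    (U : Fin N → ProbabilityMeasure Y → ℝ)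
    (hUcont : ∀ j, Continuous (U j))
    (hUconc : ∀ (j : Fin N) (μ ν σ : ProbabilityMeasure Y) (t : ℝ≥0), t ≤ 1 →
      (σ : Measure Y) = t • (μ : Measure Y) + (1 - t) • (ν : Measure Y) →
      (t : ℝ) * U j μ + (1 - (t : ℝ)) * U j ν ≤ U j σ)
    (δ : ℝ) (hδ : 0 < δ)
    (G : ProbabilityMeasure ↥X → ℝ)
    (hGcont : Continuous G)
    (hGconv : ∀ (μ ν σ : ProbabilityMeasure ↥X) (t : ℝ≥0), 0 < t → t < 1 → μ ≠ ν →
      (σ : Measure ↥X) = t • (μ : Measure ↥X) + (1 - t) • (ν : Measure ↥X) →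
      G σ < (t : ℝ) * G μ + (1 - (t : ℝ)) * G ν)
    (hGinv : ∀ (i j : Fin N) (p : ProbabilityMeasure ↥X), G (swapAlloc hXswap i j p) = G p) :
    ∃ w : Fin N → ℝ, (∀ j, 0 ≤ w j) ∧ (∑ j, w j = 1) ∧
      ∃ p : ProbabilityMeasure ↥X,
        (∀ q : ProbabilityMeasure ↥X,
          ∑ j, w j * U j (marginal q j) - δ * G q ≤ ∑ j, w j * U j (marginal p j) - δ * G p) ∧
        (∀ q : ProbabilityMeasure ↥X,
          (∀ r : ProbabilityMeasure ↥X,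
            ∑ j, w j * U j (marginal r j) - δ * G r ≤ ∑ j, w j * U j (marginal q j) - δ * G q) →
          q = p) ∧
        (∀ j k : Fin N, U j (marginal p k) ≤ U j (marginal p j)) := by
  classical
  have hBX : BorelSpace ↥X := by
    refine ⟨le_antisymm ?_ OpensMeasurableSpace.borel_le⟩
    have : Measurable[borel ↥X] (Subtype.val : ↥X → Fin N → Y) := by
      let _ : MeasurableSpace ↥X := borel ↥X
      have : BorelSpace ↥X := ⟨rfl⟩
      apply measurable_pi_iff.mpr
      intro k
      exact ((continuous_apply k).comp continuous_subtype_val).measurable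
    exact this.comap_le
  have hcX : CompactSpace ↥X := isCompact_iff_compactSpace.1 hXcomp
  have hmc : ∀ j, Continuous fun p : ProbabilityMeasure ↥X => marginal p j := fun j =>
    ProbabilityMeasure.continuous_map ((continuous_apply j).comp continuous_subtype_val)
  have hUm : ∀ j k, Continuous fun p : ProbabilityMeasure ↥X => U j (marginal p k) := fun j k =>
    (hUcont j).comp (hmc k)
  obtain ⟨x0, hx0⟩ := hXne
  have hPne : Nonempty (ProbabilityMeasure ↥X) :=
    ⟨⟨Measure.dirac ⟨x0, hx0⟩, Measure.dirac.isProbabilityMeasure⟩⟩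
  have hex : ∀ w : stdSimplex ℝ (Fin N), ∃ p : ProbabilityMeasure ↥X, ∀ q : ProbabilityMeasure ↥X,
      ∑ j, w.1 j * U j (marginal q j) - δ * G q ≤ ∑ j, w.1 j * U j (marginal p j) - δ * G p := by
    intro w
    have hc : Continuous fun q : ProbabilityMeasure ↥X =>
        ∑ j, w.1 j * U j (marginal q j) - δ * G q :=
      (continuous_finsetSum _ fun j _ => continuous_const.mul (hUm j j)).sub
        (continuous_const.mul hGcont)
    obtain ⟨p, -, hp⟩ := isCompact_univ.exists_isMaxOn Set.univ_nonempty hc.continuousOn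
    exact ⟨p, fun q => hp (Set.mem_univ q)⟩
  choose P hP using hex
  have huniq : ∀ (w : stdSimplex ℝ (Fin N)) (q : ProbabilityMeasure ↥X),
      (∀ r : ProbabilityMeasure ↥X,
        ∑ j, w.1 j * U j (marginal r j) - δ * G r ≤ ∑ j, w.1 j * U j (marginal q j) - δ * G q) →
      q = P w := fun w q hq =>
    max_unique N X U hUconc δ hδ G hGconv w.1 w.2.1 (P w) q (hP w) hq
  have hPc : Continuous P := by
    rw [continuous_iff_ultrafilter]
    intro w g hg
    obtain ⟨q, -, hq⟩ := (isCompact_univ (X := ProbabilityMeasure ↥X)).ultrafilter_le_nhds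
      (g.map P) (by simp)
    have hq' : Filter.Tendsto P g (nhds q) := hq
    have hwj : ∀ j, Filter.Tendsto (fun w : stdSimplex ℝ (Fin N) => w.1 j) g (nhds (w.1 j)) :=
      fun j => (((continuous_apply j).comp continuous_subtype_val).tendsto w).mono_left hg
    have : q = P w := by
      apply huniq
      intro r
      have t1 : Filter.Tendsto (fun w : stdSimplex ℝ (Fin N) =>
          ∑ j, w.1 j * U j (marginal r j) - δ * G r) g
          (nhds (∑ j, w.1 j * U j (marginal r j) - δ * G r)) :=
        (tendsto_finsetSum _ fun j _ => (hwj j).mul tendsto_const_nhds).sub tendsto_const_nhds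
      have t2 : Filter.Tendsto (fun w : stdSimplex ℝ (Fin N) =>
          ∑ j, w.1 j * U j (marginal (P w) j) - δ * G (P w)) g
          (nhds (∑ j, w.1 j * U j (marginal q j) - δ * G q)) :=
        (tendsto_finsetSum _ fun j _ => (hwj j).mul (((hUm j j).tendsto q).comp hq')).sub
          (tendsto_const_nhds.mul ((hGcont.tendsto q).comp hq'))
      exact le_of_tendsto_of_tendsto' t1 t2 fun w => hP w r
    rw [← this]; exact hq'
  let d : stdSimplex ℝ (Fin N) → Fin N → ℝ := fun w j =>
    ∑ k, max (U j (marginal (P w) k) - U j (marginal (P w) j)) 0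
  have hd0 : ∀ w j, 0 ≤ d w j := fun w j => Finset.sum_nonneg fun k _ => le_max_right _ _
  have hdc : ∀ j, Continuous fun w => d w j := fun j =>
    continuous_finsetSum _ fun k _ =>
      ((((hUm j k).comp hPc).sub ((hUm j j).comp hPc)).max continuous_const)
  obtain ⟨w, hw⟩ := simplex_fixed N hN d hd0 hdc
  refine ⟨w.1, w.2.1, w.2.2, P w, hP w, huniq w, ?_⟩
  obtain ⟨j, hj, hjk⟩ := exists_noenvy N w.1 w.2.1 w.2.2
    (fun j k => U j (marginal (P w) k)) (by
      intro σ
      obtain ⟨q, hq, hq'⟩ := exists_perm hXswap G hGinv (P w) σ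
      have := hP w q
      simp only [hq, hq'] at this
      linarith)
  have hdj : d w j = 0 := Finset.sum_eq_zero fun k _ => by
    rw [max_eq_right]; linarith [hjk k]
  have hS : ∑ j, d w j = 0 := by
    have := hw j
    rw [hdj] at this
    exact (mul_eq_zero.1 this.symm).resolve_left hj.ne'
  intro i k
  have h1 : d w i = 0 := by rw [hw i, hS, mul_zero]
  have h2 := (Finset.sum_eq_zero_iff_of_nonneg (fun k _ => le_max_right _ _)).1 h1 k
    (Finset.mem_univ k)
  have h3 := le_max_left (U i (marginal (P w) k) - U i (marginal (P w) i)) 0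
  linarith
end

section
/- There exists an allocation p ∈ Δ(X) that is both weakly Pareto efficient (there is no p' ∈ Δ(X) with U_j(p') > U_j(p) for all j) and envy-free (U_j(p^j) ≥ U_j(p^k) for all j,k). -/
open MeasureTheory
open scoped NNReal

open Polynomial in
theorem det_interp {E : Type*} [NormedAddCommGroup E] [NormedSpace ℝ E] [FiniteDimensional ℝ E]
    (A : E →L[ℝ] E) (v : ℕ → ℝ) (hv : Function.Injective v) :
    (ContinuousLinearMap.id ℝ E + A).det =
      ∑ i ∈ Finset.range (Module.finrank ℝ E + 1),
        (ContinuousLinearMap.id ℝ E + v i • A).det *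
          (Lagrange.basis (Finset.range (Module.finrank ℝ E + 1)) v i).eval 1 := by
  classical
  let b := Module.finBasis ℝ E
  let M := LinearMap.toMatrix b b (A : E →ₗ[ℝ] E)
  let P : ℝ[X] := Matrix.det ((X : ℝ[X]) • M.map C + (1 : Matrix _ _ ℝ).map C)
  have hdeg : P.natDegree ≤ Module.finrank ℝ E := by
    simpa only [Fintype.card_fin] using Polynomial.natDegree_det_X_add_C_le M 1
  have hev : ∀ t : ℝ, P.eval t = (ContinuousLinearMap.id ℝ E + t • A).det := by
    intro t
    have h1 : (ContinuousLinearMap.id ℝ E + t • A).det = (t • M + 1).det := by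
      rw [ContinuousLinearMap.det, ← LinearMap.det_toMatrix b]
      congr 1
      simp only [ContinuousLinearMap.toLinearMap_add, ContinuousLinearMap.toLinearMap_smul, ContinuousLinearMap.coe_id,
        map_add, map_smul, LinearMap.toMatrix_id, M]
      rw [add_comm]
    rw [h1]
    change (Polynomial.evalRingHom t) P = _
    simp only [P, RingHom.map_det]
    congr 1
    ext i j
    by_cases h : i = j <;> simp [h] <;> ring
  have hP : P = Lagrange.interpolate (Finset.range (Module.finrank ℝ E + 1)) v
      fun i => P.eval (v i) := by
    apply Lagrange.eq_interpolate hv.injOn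
    rw [Finset.card_range]
    exact (Polynomial.degree_le_natDegree).trans_lt (by exact_mod_cast Nat.lt_succ_of_le hdeg)
  have := congrArg (Polynomial.eval (1:ℝ)) hP
  rw [hev] at this
  simp only [one_smul] at this
  rw [this, Lagrange.interpolate_apply, Polynomial.eval_finsetSum]
  simp [hev]

theorem no_retraction {E : Type*} [NormedAddCommGroup E] [InnerProductSpace ℝ E]
    [FiniteDimensional ℝ E] (r : E → E)
    (hr : ∀ x ∈ Metric.closedBall (0:E) 1, ContDiffAt ℝ 1 r x)
    (hn : ∀ x ∈ Metric.closedBall (0:E) 1, ‖r x‖ = 1)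
    (hb : ∀ x : E, ‖x‖ = 1 → r x = x) : False := by
  classical
  borelize E
  let μ : Measure E := Measure.addHaar
  set B := Metric.closedBall (0:E) 1 with hB
  have hBc : IsCompact B := isCompact_closedBall _ _
  let g : E → E := fun x => r x - x
  have hg : ∀ x ∈ B, ContDiffAt ℝ 1 g x := fun x hx => (hr x hx).sub contDiffAt_id
  let A : E → E →L[ℝ] E := fderiv ℝ g
  have hgA : ∀ x ∈ B, HasFDerivAt g (A x) x := fun x hx =>
    ((hg x hx).differentiableAt (by norm_num)).hasFDerivAt
  have hAc : ContinuousOn A B := fun x hx =>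
    ((hg x hx).continuousAt_fderiv (by norm_num)).continuousWithinAt
  obtain ⟨K, hK⟩ := hBc.exists_bound_of_continuousOn hAc
  have hK0 : 0 ≤ K := (norm_nonneg _).trans (hK 0 (by simp [hB]))
  have hlip : ∀ x ∈ B, ∀ y ∈ B, ‖g y - g x‖ ≤ K * ‖y - x‖ := fun x hx y hy =>
    (convex_closedBall (0:E) 1).norm_image_sub_le_of_norm_hasFDerivWithin_le
      (fun z hz => (hgA z hz).hasFDerivWithinAt) hK hx hy
  let G : E → E := fun x => if x ∈ B then g x else 0
  have hGout : ∀ x, 1 ≤ ‖x‖ → G x = 0 := by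
    intro x hx
    by_cases h : x ∈ B
    · have : ‖x‖ = 1 := le_antisymm (by simpa [hB] using h) hx
      simp [G, g, hb x this]
    · simp [G, h]
  have hGio : ∀ x ∈ B, ∀ y ∉ B, ‖G y - G x‖ ≤ K * ‖y - x‖ := by
    intro x hx y hy
    have hx' : ‖x‖ ≤ 1 := by simpa [hB] using hx
    have hy' : 1 < ‖y‖ := by simpa [hB] using hy
    obtain ⟨s, hs, hs1⟩ : ∃ s ∈ Set.Icc (0:ℝ) 1, ‖x + s • (y - x)‖ = 1 := by
      have hc : ContinuousOn (fun s : ℝ => ‖x + s • (y - x)‖) (Set.Icc 0 1) := by fun_prop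
      have := intermediate_value_Icc (zero_le_one' ℝ) hc
      apply this
      constructor
      · simpa using hx'
      · simpa using hy'.le
    set z := x + s • (y - x) with hz
    have hzB : z ∈ B := by simp [hB, hs1]
    have e1 : G y = G z := by rw [hGout y hy'.le, hGout z hs1.ge]
    rw [e1]
    have := hlip x hx z hzB
    simp only [G, hx, hzB, if_true]
    refine this.trans ?_
    gcongr
    rw [hz, add_sub_cancel_left, norm_smul, Real.norm_of_nonneg hs.1]
    exact mul_le_of_le_one_left (norm_nonneg _) hs.2
  have hGlip : ∀ x y, ‖G y - G x‖ ≤ K * ‖y - x‖ := by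
    intro x y
    by_cases hx : x ∈ B <;> by_cases hy : y ∈ B
    · simpa [G, hx, hy] using hlip x hx y hy
    · exact hGio x hx y hy
    · rw [norm_sub_rev, norm_sub_rev y x]; exact hGio y hy x hx
    · simp only [G, hx, hy, if_false, sub_self, norm_zero]; positivity
  set S := Metric.ball (0:E) 1 with hS
  have hSB : S ⊆ B := Metric.ball_subset_closedBall
  -- volume computation for small t
  obtain ⟨δ, hδ, hdet⟩ : ∃ δ > 0, ∀ L : E →L[ℝ] E, ‖L‖ < δ →
      0 < (ContinuousLinearMap.id ℝ E + L).det := by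
    have hc : Continuous fun L : E →L[ℝ] E => (ContinuousLinearMap.id ℝ E + L).det :=
      ContinuousLinearMap.continuous_det.comp (continuous_const.add continuous_id)
    have h0 : (0:ℝ) < (ContinuousLinearMap.id ℝ E + (0 : E →L[ℝ] E)).det := by
      simp [ContinuousLinearMap.det]
    have := hc.continuousAt.eventually (lt_mem_nhds h0)
    obtain ⟨δ, hδ, h⟩ := Metric.eventually_nhds_iff.1 this
    exact ⟨δ, hδ, fun L hL => h (by simpa using hL)⟩
  have hvol : ∀ t : ℝ, 0 < t → t < 1 → t * K < 1 → t * K < δ →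
      ∫ x in S, (ContinuousLinearMap.id ℝ E + t • A x).det ∂μ = μ.real S := by
    intro t t0 t1 tK tδ
    let F : E → E := fun x => x + t • G x
    have hinj : Function.Injective F := by
      intro x y hxy
      have h1 : x - y = t • (G y - G x) := by
        have : x + t • G x = y + t • G y := hxy
        rw [smul_sub, sub_eq_sub_iff_add_eq_add, this, add_comm]
      have h2 : ‖x - y‖ ≤ t * K * ‖x - y‖ := by
        calc ‖x - y‖ = t * ‖G y - G x‖ := by
              conv_lhs => rw [h1]
              rw [norm_smul, Real.norm_of_nonneg t0.le]
          _ ≤ t * (K * ‖y - x‖) := by gcongr; exact hGlip x y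
          _ = _ := by rw [norm_sub_rev]; ring
      have h3 : ‖x - y‖ = 0 := by nlinarith [norm_nonneg (x - y)]
      exact sub_eq_zero.1 (norm_eq_zero.1 h3)
    have hsurj : Function.Surjective F := by
      intro y
      have hc : ContractingWith (Real.toNNReal (t * K)) (fun x => y - t • G x) := by
        refine ⟨by rw [Real.toNNReal_lt_one]; exact tK, LipschitzWith.of_dist_le_mul fun a b => ?_⟩
        rw [dist_eq_norm, dist_eq_norm]
        have : y - t • G a - (y - t • G b) = t • (G b - G a) := by rw [smul_sub]; abel
        rw [this, norm_smul, Real.norm_of_nonneg t0.le, norm_sub_rev a b]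
        calc t * ‖G b - G a‖ ≤ t * (K * ‖b - a‖) := by gcongr; exact hGlip a b
          _ = _ := by rw [Real.coe_toNNReal _ (by positivity)]; ring
      have := hc.fixedPoint_isFixedPt
      refine ⟨ContractingWith.fixedPoint _ hc, ?_⟩
      have h2 : y - t • G (ContractingWith.fixedPoint _ hc) = ContractingWith.fixedPoint _ hc := this
      exact (sub_eq_iff_eq_add.1 h2).symm
    have hFS : ∀ x ∈ S, F x = x + t • g x := by
      intro x hx
      simp [F, G, hSB hx]
    have himg : (fun x => x + t • g x) '' S = S := by
      apply Set.Subset.antisymm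
      · rintro _ ⟨x, hx, rfl⟩
        have hx1 : ‖x‖ < 1 := by simpa [hS] using hx
        have e : x + t • g x = (1 - t) • x + t • r x := by
          simp only [g, smul_sub, sub_smul, one_smul]; abel
        simp only [hS, mem_ball_zero_iff, e]
        calc ‖(1 - t) • x + t • r x‖ ≤ (1 - t) * ‖x‖ + t * ‖r x‖ := by
              refine (norm_add_le _ _).trans ?_
              rw [norm_smul, norm_smul, Real.norm_of_nonneg t0.le,
                Real.norm_of_nonneg (by linarith)]
          _ < 1 := by rw [hn x (hSB hx)]; nlinarith
      · intro y hy
        obtain ⟨x, hx⟩ := hsurj y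
        have hxS : x ∈ S := by
          by_contra h
          have : 1 ≤ ‖x‖ := by simpa [hS] using h
          have h2 : F x = x := by simp [F, hGout x this]
          rw [h2] at hx
          exact h (hx ▸ hy)
        exact ⟨x, hxS, by rw [← hx, hFS x hxS]⟩
    have hinjS : Set.InjOn (fun x => x + t • g x) S := by
      intro x hx y hy hxy
      apply hinj
      rw [hFS x hx, hFS y hy]; exact hxy
    have hder : ∀ x ∈ S, HasFDerivWithinAt (fun x => x + t • g x)
        (ContinuousLinearMap.id ℝ E + t • A x) S x := fun x hx =>
      ((hasFDerivAt_id x).add ((hgA x (hSB hx)).const_smul t)).hasFDerivWithinAt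
    have := integral_image_eq_integral_abs_det_fderiv_smul μ measurableSet_ball hder hinjS
      (fun _ => (1:ℝ))
    rw [himg] at this
    simp only [smul_eq_mul, mul_one, integral_const, measureReal_restrict_apply_univ] at this
    rw [this]
    apply setIntegral_congr_fun measurableSet_ball
    intro x hx
    refine (abs_of_pos (hdet _ ?_)).symm
    rw [norm_smul, Real.norm_of_nonneg t0.le]
    exact (mul_le_mul_of_nonneg_left (hK x (hSB hx)) t0.le).trans_lt tδ
  -- nodes
  obtain ⟨c, hc0, hc1⟩ : ∃ c : ℝ, 0 < c ∧ ∀ t, 0 < t → t ≤ c → t < 1 ∧ t * K < 1 ∧ t * K < δ := by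
    refine ⟨min (1/2) (min (1 / (2 * (K+1))) (δ / (2 * (K + 1)))), by positivity, ?_⟩
    intro t t0 ht
    have h1 := ht.trans (min_le_left _ _)
    have h2 := (ht.trans (min_le_right _ _)).trans (min_le_left _ _)
    have h3 := (ht.trans (min_le_right _ _)).trans (min_le_right _ _)
    rw [le_div_iff₀ (by positivity)] at h2 h3
    refine ⟨by linarith, by nlinarith, by nlinarith⟩
  let v : ℕ → ℝ := fun i => c / (i + 1)
  have hv0 : ∀ i, 0 < v i := fun i => by positivity
  have hvc : ∀ i, v i ≤ c := fun i => div_le_self hc0.le (by simp)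
  have hvinj : Function.Injective v := by
    intro i j hij
    have hij' : c / ((i:ℝ) + 1) = c / (j + 1) := hij
    rw [div_eq_div_iff (by positivity) (by positivity)] at hij'
    have := mul_left_cancel₀ hc0.ne' hij'
    have : (i:ℝ) = j := by linarith
    exact_mod_cast this
  have hint : ∀ t : ℝ, IntegrableOn (fun x => (ContinuousLinearMap.id ℝ E + t • A x).det) S μ := by
    intro t
    refine IntegrableOn.mono_set (ContinuousOn.integrableOn_compact hBc ?_) hSB
    exact ContinuousLinearMap.continuous_det.comp_continuousOn
      (continuousOn_const.add (hAc.const_smul t))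
  have hzero : ∀ x ∈ S, (ContinuousLinearMap.id ℝ E + A x).det = 0 := by
    intro x hx
    have hxB := hSB hx
    have hrd : HasFDerivAt r (ContinuousLinearMap.id ℝ E + A x) x := by
      have := (hasFDerivAt_id (𝕜 := ℝ) x).add (hgA x hxB)
      refine this.congr_of_eventuallyEq (Filter.Eventually.of_forall fun y => ?_)
      simp [g]
    have hd2 := hrd.inner ℝ hrd
    have hcst : (fun y => inner ℝ (r y) (r y)) =ᶠ[nhds x] fun _ => (1:ℝ) := by
      filter_upwards [Metric.isOpen_ball.mem_nhds hx] with y hy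
      rw [real_inner_self_eq_norm_sq, hn y (hSB hy)]; norm_num
    have hu := hd2.unique ((hasFDerivAt_const (1:ℝ) x).congr_of_eventuallyEq hcst)
    by_contra hne
    set L := ContinuousLinearMap.id ℝ E + A x with hL
    have hsur : Function.Surjective L := by
      have hne' : LinearMap.det (L : E →ₗ[ℝ] E) ≠ 0 := hne
      exact (LinearEquiv.ofIsUnitDet (f := (L : E →ₗ[ℝ] E)) (v := Module.finBasis ℝ E)
        (v' := Module.finBasis ℝ E) (by
          rw [LinearMap.det_toMatrix]; exact isUnit_iff_ne_zero.2 hne')).surjective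
    obtain ⟨h, hh⟩ := hsur (r x)
    have := congrArg (fun T : E →L[ℝ] ℝ => T h) hu
    simp [hh, hn x hxB] at this
  have key : ∫ x in S, (ContinuousLinearMap.id ℝ E + A x).det ∂μ = μ.real S := by
    simp_rw [fun x => det_interp (A x) v hvinj]
    rw [integral_finsetSum _ (fun i _ => (hint (v i)).mul_const _)]
    simp_rw [integral_mul_const]
    have : ∀ i, ∫ x in S, (ContinuousLinearMap.id ℝ E + v i • A x).det ∂μ = μ.real S := fun i =>
      let h := hc1 (v i) (hv0 i) (hvc i)
      hvol (v i) (hv0 i) h.1 h.2.1 h.2.2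
    simp_rw [this]
    rw [← Finset.mul_sum, ← Polynomial.eval_finsetSum, Lagrange.sum_basis hvinj.injOn (by simp)]
    simp
  rw [setIntegral_congr_fun measurableSet_ball hzero] at key
  have hpos : 0 < μ.real S := by
    rw [measureReal_def]
    exact ENNReal.toReal_pos (Metric.measure_ball_pos μ _ one_pos).ne' measure_ball_lt_top.ne
  simp at key
  linarith

theorem brouwer_ball {E : Type*} [NormedAddCommGroup E] [InnerProductSpace ℝ E]
    [FiniteDimensional ℝ E] (f : E → E) (hf : Continuous f) (hf1 : ∀ x, ‖f x‖ ≤ 1) :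
    ∃ x, f x = x := by
  by_contra hno
  push Not at hno
  have hBc : IsCompact (Metric.closedBall (0:E) 1) := isCompact_closedBall _ _
  obtain ⟨x0, -, hx0⟩ := hBc.exists_isMinOn ⟨0, by simp⟩
    (f := fun x => ‖f x - x‖) (by fun_prop)
  set ε := ‖f x0 - x0‖ with hε
  have hε0 : 0 < ε := norm_pos_iff.2 (sub_ne_zero.2 (hno x0))
  have hεle : ∀ x, ‖x‖ ≤ 1 → ε ≤ ‖f x - x‖ := fun x hx => hx0 (by simpa using hx)
  obtain ⟨g, hg, hgf, -⟩ := hf.exists_contDiff_approx 1 (ε := fun _ => ε / 2)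
    continuous_const (fun _ => by positivity)
  let c : ℝ := (1 + ε / 2)⁻¹
  have hc0 : 0 < c := by positivity
  have hcε : c * (1 + ε / 2) = 1 := inv_mul_cancel₀ (by positivity)
  let h : E → E := fun x => c • g x
  have hgn : ∀ x, ‖g x‖ < 1 + ε / 2 := by
    intro x
    have h1 := hgf x
    rw [dist_eq_norm] at h1
    have h2 := norm_add_le (g x - f x) (f x)
    rw [sub_add_cancel] at h2
    linarith [hf1 x]
  have hh1 : ∀ x, ‖h x‖ < 1 := by
    intro x
    simp only [h, norm_smul, Real.norm_of_nonneg hc0.le]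
    nlinarith [hgn x]
  have hhne : ∀ x, ‖x‖ ≤ 1 → x - h x ≠ 0 := by
    intro x hx he
    have hxe : x = h x := sub_eq_zero.1 he
    have h1 := hεle x hx
    have h2 := hgf x
    rw [dist_eq_norm] at h2
    have h3 : ‖g x - h x‖ ≤ ε / 2 := by
      have : g x - h x = (1 - c) • g x := by simp [h, sub_smul]
      have hc1 : 1 - c = c * (ε / 2) := by linarith
      rw [this, hc1, norm_smul, Real.norm_of_nonneg (by positivity)]
      have := mul_le_mul_of_nonneg_left (hgn x).le (show 0 ≤ c * (ε / 2) by positivity)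
      nlinarith
    have h4 : f x - x = -(g x - f x) + (g x - h x) := by
      rw [← hxe]; abel
    have h5 := norm_add_le (-(g x - f x)) (g x - h x)
    rw [← h4, norm_neg] at h5
    linarith
  have hhC : ContDiff ℝ 1 h := contDiff_const.smul hg
  let u : E → E := fun x => x - h x
  have huC : ContDiff ℝ 1 u := contDiff_id.sub hhC
  let a : E → ℝ := fun x => ‖u x‖ ^ 2
  let b : E → ℝ := fun x => inner ℝ x (u x)
  let D : E → ℝ := fun x => b x ^ 2 + (1 - ‖x‖ ^ 2) * a x
  let s : E → ℝ := fun x => (-b x + Real.sqrt (D x)) / a x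
  have haC : ContDiff ℝ 1 a := huC.norm_sq ℝ
  have hbC : ContDiff ℝ 1 b := contDiff_id.inner ℝ huC
  have hDC : ContDiff ℝ 1 D := (hbC.pow 2).add ((contDiff_const.sub (contDiff_norm_sq ℝ)).mul haC)
  have ha0 : ∀ x, ‖x‖ ≤ 1 → 0 < a x := fun x hx => by
    have := norm_pos_iff.2 (hhne x hx)
    simp only [a, u]; positivity
  have hb0 : ∀ x, ‖x‖ = 1 → 0 < b x := by
    intro x hx
    simp only [b, u, inner_sub_right, real_inner_self_eq_norm_sq, hx]
    have := real_inner_le_norm x (h x)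
    rw [hx] at this
    linarith [hh1 x]
  have hD0 : ∀ x, ‖x‖ ≤ 1 → 0 < D x := by
    intro x hx
    rcases hx.lt_or_eq with h1 | h1
    · have : 0 < 1 - ‖x‖ ^ 2 := by nlinarith [norm_nonneg x]
      have := mul_pos this (ha0 x hx)
      simp only [D]; positivity
    · have := hb0 x h1
      simp only [D, h1]; simp; positivity
  refine no_retraction (fun x => x + s x • u x) ?_ ?_ ?_
  · intro x hx
    have hx : ‖x‖ ≤ 1 := by simpa using hx
    refine contDiffAt_id.add (ContDiffAt.smul ?_ huC.contDiffAt)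
    exact ((hbC.contDiffAt.neg).add (hDC.contDiffAt.sqrt (hD0 x hx).ne')).div haC.contDiffAt
      (ha0 x hx).ne'
  · intro x hx
    have hx : ‖x‖ ≤ 1 := by simpa using hx
    have hsa : s x * a x = -b x + Real.sqrt (D x) := div_mul_cancel₀ _ (ha0 x hx).ne'
    have hsq := Real.sq_sqrt (hD0 x hx).le
    have e : ‖x + s x • u x‖ ^ 2 = ‖x‖ ^ 2 + 2 * (s x * b x) + s x ^ 2 * a x := by
      rw [norm_add_sq_real, real_inner_smul_right, norm_smul, mul_pow, Real.norm_eq_abs, sq_abs]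
    have e2 : a x * (s x ^ 2 * a x + 2 * (s x * b x)) = a x * (1 - ‖x‖ ^ 2) := by
      have : Real.sqrt (D x) = s x * a x + b x := by linarith
      rw [this] at hsq
      simp only [D] at hsq
      linarith
    have e3 := mul_left_cancel₀ (ha0 x hx).ne' e2
    have e4 : ‖x + s x • u x‖ ^ 2 = 1 := by rw [e]; linarith
    exact (pow_eq_one_iff_of_nonneg (norm_nonneg _) two_ne_zero).1 e4
  · intro x hx
    have hb := hb0 x hx
    have : D x = b x ^ 2 := by simp [D, hx]
    simp [s, this, Real.sqrt_sq hb.le]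

theorem brouwer_simplex {N : ℕ} (hN : 1 ≤ N) (φ : (Fin N → ℝ) → (Fin N → ℝ))
    (hc : ContinuousOn φ (stdSimplex ℝ (Fin N)))
    (hm : ∀ x ∈ stdSimplex ℝ (Fin N), φ x ∈ stdSimplex ℝ (Fin N)) :
    ∃ x ∈ stdSimplex ℝ (Fin N), φ x = x := by
  let P : (Fin N → ℝ) → ℝ := fun x => ∑ j, max (x j) 0
  let R : (Fin N → ℝ) → (Fin N → ℝ) := fun x j =>
    (max (x j) 0 + max (1 - P x) 0 / N) / max (P x) 1
  have hP : Continuous P := by fun_prop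
  have hRc : Continuous R := by
    refine continuous_pi fun j => Continuous.div (by fun_prop) (by fun_prop) fun x => ?_
    positivity
  have hN0 : (N:ℝ) ≠ 0 := by positivity
  have hRm : ∀ x, R x ∈ stdSimplex ℝ (Fin N) := by
    intro x
    refine ⟨fun j => by simp only [R]; positivity, ?_⟩
    simp only [R]
    rw [← Finset.sum_div, Finset.sum_add_distrib, div_eq_one_iff_eq (by positivity)]
    simp only [Finset.sum_const, Finset.card_univ, Fintype.card_fin, nsmul_eq_mul]
    rw [mul_div_cancel₀ _ hN0]
    change P x + _ = _
    rcases le_total (P x) 1 with h | h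
    · rw [max_eq_left (by linarith), max_eq_right h]; ring
    · rw [max_eq_right (by linarith), max_eq_left h]; ring
  have hRid : ∀ x ∈ stdSimplex ℝ (Fin N), R x = x := by
    intro x hx
    have h1 : ∀ j, max (x j) 0 = x j := fun j => max_eq_left (hx.1 j)
    have h2 : P x = 1 := by simp only [P, h1]; exact hx.2
    ext j
    simp [R, h1, h2]
  have hφR : Continuous fun x => φ (R x) := hc.comp_continuous hRc hRm
  let f : EuclideanSpace ℝ (Fin N) → EuclideanSpace ℝ (Fin N) := fun y => WithLp.toLp 2 (φ (R y.ofLp))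
  obtain ⟨y, hy⟩ := brouwer_ball f
    ((PiLp.continuous_toLp 2 _).comp (hφR.comp (PiLp.continuous_ofLp 2 _))) (by
      intro y
      have hs := hm _ (hRm y.ofLp)
      rw [EuclideanSpace.norm_eq, Real.sqrt_le_one, ← hs.2]
      refine Finset.sum_le_sum fun j _ => ?_
      have h0 := hs.1 j
      have h1 : φ (R y.ofLp) j ≤ 1 := by
        rw [← hs.2]; exact Finset.single_le_sum (fun i _ => hs.1 i) (Finset.mem_univ j)
      simp only [f, Real.norm_eq_abs, sq_abs]
      nlinarith)
  have hy' : φ (R y.ofLp) = y.ofLp := congrArg WithLp.ofLp hy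
  have hys : y.ofLp ∈ stdSimplex ℝ (Fin N) := hy' ▸ hm _ (hRm _)
  exact ⟨y.ofLp, hys, by rw [hRid _ hys] at hy'; exact hy'⟩

theorem perm_contra {N : ℕ} (lam : Fin N → ℝ) (h0 : ∀ j, 0 ≤ lam j) (v : Fin N → Fin N → ℝ)
    (hmax : ∀ σ : Equiv.Perm (Fin N), ∑ j, lam j * v j (σ j) ≤ ∑ j, lam j * v j j)
    (henvy : ∀ j, 0 < lam j → ∃ k, v j j < v j k) (hpos : ∃ j, 0 < lam j) : False := by
  classical
  have base : ∀ σ : Equiv.Perm (Fin N), (∀ j, 0 < lam j → v j j ≤ v j (σ j)) →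
      (∃ j, 0 < lam j ∧ v j j < v j (σ j)) → False := by
    rintro σ h1 ⟨j, hj, hj2⟩
    refine absurd (hmax σ) (not_le.2 ?_)
    refine Finset.sum_lt_sum (fun i _ => ?_) ⟨j, Finset.mem_univ j, mul_lt_mul_of_pos_left hj2 hj⟩
    rcases (h0 i).eq_or_lt with h | h
    · simp [← h]
    · exact mul_le_mul_of_nonneg_left (h1 i h) h.le
  have henvy' : ∀ j, ∃ k, 0 < lam j → v j j < v j k := fun j => by
    by_cases h : 0 < lam j
    · obtain ⟨k, hk⟩ := henvy j h; exact ⟨k, fun _ => hk⟩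
    · exact ⟨j, fun h' => absurd h' h⟩
  choose e he using henvy'
  have heS : ∀ j, 0 < lam j → 0 < lam (e j) := by
    intro j hj
    by_contra hk
    refine base (Equiv.swap j (e j)) (fun i hi => ?_) ⟨j, hj, ?_⟩
    · by_cases hij : i = j
      · subst hij; rw [Equiv.swap_apply_left]; exact (he _ hi).le
      · by_cases hik : i = e j
        · rw [hik] at hi; exact absurd hi hk
        · rw [Equiv.swap_apply_of_ne_of_ne hij hik]
    · rw [Equiv.swap_apply_left]; exact he j hj
  obtain ⟨j0, hj0⟩ := hpos
  have hit : ∀ n : ℕ, 0 < lam (e^[n] j0) := by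
    intro n
    induction n with
    | zero => exact hj0
    | succ n ih => rw [Function.iterate_succ_apply']; exact heS _ ih
  obtain ⟨m, n, hmn, hmn2⟩ : ∃ m n : ℕ, m < n ∧ e^[m] j0 = e^[n] j0 := by
    obtain ⟨m, n, hne, h⟩ := Finite.exists_ne_map_eq_of_infinite (fun n : ℕ => e^[n] j0)
    rcases lt_or_gt_of_ne hne with h' | h'
    · exact ⟨m, n, h', h⟩
    · exact ⟨n, m, h', h.symm⟩
  have hper : e^[m] j0 ∈ Function.periodicPts e := by
    refine Function.mk_mem_periodicPts (n := n - m) (by omega) ?_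
    change e^[n - m] (e^[m] j0) = _
    rw [← Function.iterate_add_apply, Nat.sub_add_cancel hmn.le, hmn2]
  have hbij := Function.bijOn_periodicPts e
  let s : Fin N → Fin N := fun j => if j ∈ Function.periodicPts e then e j else j
  have hsinj : Function.Injective s := by
    intro a b hab
    simp only [s] at hab
    split_ifs at hab with ha hb hb
    · exact hbij.injOn ha hb hab
    · exact absurd (hab ▸ hbij.mapsTo ha) hb
    · exact absurd (hab ▸ hbij.mapsTo hb) ha
    · exact hab
  let σ : Equiv.Perm (Fin N) := Equiv.ofBijective s (Finite.injective_iff_bijective.1 hsinj)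
  have hσ : ∀ j, σ j = s j := fun _ => rfl
  refine base σ (fun j hj => ?_) ⟨e^[m] j0, hit m, ?_⟩
  · rw [hσ]; simp only [s]
    split_ifs
    · exact (he j hj).le
    · exact le_rfl
  · rw [hσ]; simp only [s, hper, if_true]
    exact he _ (hit m)

theorem abstract_existence {D : Type*} [TopologicalSpace D] [CompactSpace D] [Nonempty D]
    {N : ℕ} (hN : 1 ≤ N) (V : Fin N → Fin N → D → ℝ) (hV : ∀ j k, Continuous (V j k))
    (hperm : ∀ (σ : Equiv.Perm (Fin N)) (p : D), ∃ p' : D, ∀ j k, V j k p' = V j (σ k) p)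
    (hmix : ∀ (ι : Type) [Fintype ι] (p : ι → D), ∃ m : (ι → ℝ) → D,
      ContinuousOn m (stdSimplex ℝ ι) ∧
      ∀ w ∈ stdSimplex ℝ ι, ∀ j k, ∑ i, w i * V j k (p i) ≤ V j k (m w)) :
    ∃ p : D, (¬ ∃ p', ∀ j, V j j p < V j j p') ∧ ∀ j k, V j k p ≤ V j j p := by
  classical
  let S := stdSimplex ℝ (Fin N)
  have hSc : IsCompact S := isCompact_stdSimplex ℝ (Fin N)
  let W : (Fin N → ℝ) → D → ℝ := fun l p => ∑ j, l j * V j j p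
  have hWp : ∀ l, Continuous (W l) := fun l => by
    simp only [W]
    exact continuous_finsetSum _ fun j _ => continuous_const.mul (hV j j)
  let f : Fin N → D → ℝ := fun j p => ∑ k, max 0 (V j k p - V j j p)
  have hfc : ∀ j, Continuous (f j) := fun j =>
    continuous_finsetSum _ fun k _ => continuous_const.max ((hV j k).sub (hV j j))
  have hf0 : ∀ j p, 0 ≤ f j p := fun j p => Finset.sum_nonneg fun k _ => le_max_left _ _
  let Φ : D → ℝ := fun p => ∑ j, f j p
  have hΦc : Continuous Φ := continuous_finsetSum _ fun j _ => hfc j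
  have hΦ0 : ∀ p, 0 ≤ Φ p := fun p => Finset.sum_nonneg fun j _ => hf0 j p
  -- bound
  obtain ⟨M, hM0, hM⟩ : ∃ M : ℝ, 0 < M ∧ ∀ p, ∑ j, |V j j p| ≤ M := by
    have hc : Continuous fun p => ∑ j, |V j j p| :=
      continuous_finsetSum _ fun j _ => (hV j j).abs
    obtain ⟨C, hC⟩ := isCompact_univ.exists_bound_of_continuousOn hc.continuousOn
    exact ⟨max C 1, by positivity, fun p =>
      (le_abs_self _).trans ((hC p trivial).trans (le_max_left _ _))⟩
  have hWlip : ∀ l l' p, W l p ≤ W l' p + M * dist l l' := by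
    intro l l' p
    have h1 : W l p - W l' p ≤ ∑ j, dist l l' * |V j j p| := by
      simp only [W]
      rw [← Finset.sum_sub_distrib]
      refine Finset.sum_le_sum fun j _ => ?_
      rw [← sub_mul]
      refine (le_abs_self _).trans ?_
      rw [abs_mul]
      gcongr
      have := dist_le_pi_dist l l' j
      rwa [Real.dist_eq] at this
    rw [← Finset.mul_sum] at h1
    have := mul_le_mul_of_nonneg_left (hM p) (dist_nonneg (x := l) (y := l'))
    linarith
  let T : ℝ → Set ((Fin N → ℝ) × D) := fun ε => {z | z.1 ∈ S ∧
    (∀ q, W z.1 q ≤ W z.1 z.2 + ε) ∧ ∀ j, f j z.2 = z.1 j * Φ z.2}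
  have hWc : Continuous fun z : (Fin N → ℝ) × D => W z.1 z.2 :=
    continuous_finsetSum _ fun j _ =>
      ((continuous_apply j).comp continuous_fst).mul ((hV j j).comp continuous_snd)
  have hWc1 : ∀ q, Continuous fun z : (Fin N → ℝ) × D => W z.1 q := fun q =>
    continuous_finsetSum _ fun j _ =>
      ((continuous_apply j).comp continuous_fst).mul continuous_const
  have hTclosed : ∀ ε, IsClosed (T ε) := by
    intro ε
    refine (hSc.isClosed.preimage continuous_fst).inter (IsClosed.inter ?_ ?_)
    · change IsClosed {z : (Fin N → ℝ) × D | ∀ q, W z.1 q ≤ W z.1 z.2 + ε}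
      rw [Set.ofPred_forall]
      exact isClosed_iInter fun q => isClosed_le (hWc1 q) (hWc.add continuous_const)
    · change IsClosed {z : (Fin N → ℝ) × D | ∀ j, f j z.2 = z.1 j * Φ z.2}
      rw [Set.ofPred_forall]
      exact isClosed_iInter fun j => isClosed_eq ((hfc j).comp continuous_snd)
        (((continuous_apply j).comp continuous_fst).mul (hΦc.comp continuous_snd))
  have hTne : ∀ ε, 0 < ε → (T ε).Nonempty := by
    intro ε hε
    let δ := ε / (2 * M)
    have hδ : 0 < δ := by positivity
    have hδM : 2 * (M * δ) = ε := by simp only [δ]; field_simp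
    obtain ⟨t, htS, htfin, htcov⟩ := hSc.finite_cover_balls hδ
    have : Fintype t := htfin.fintype
    have hmaxi : ∀ i : t, ∃ p, ∀ q, W i q ≤ W i p := fun i => by
      obtain ⟨p, -, hp⟩ := isCompact_univ.exists_isMaxOn Set.univ_nonempty (hWp i).continuousOn
      exact ⟨p, fun q => hp (Set.mem_univ q)⟩
    choose P hP using hmaxi
    obtain ⟨m, hmc, hmV⟩ := hmix t P
    let a : (Fin N → ℝ) → t → ℝ := fun l i => max 0 (δ - dist l i)
    have ha0 : ∀ l i, 0 ≤ a l i := fun l i => le_max_left _ _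
    have hac : ∀ i, Continuous fun l => a l i := fun i => by
      simp only [a]; fun_prop
    let A : (Fin N → ℝ) → ℝ := fun l => ∑ i, a l i
    have hA0 : ∀ l ∈ S, 0 < A l := by
      intro l hl
      obtain ⟨i, hi, hli⟩ := Set.mem_iUnion₂.1 (htcov hl)
      have : 0 < a l ⟨i, hi⟩ := lt_max_of_lt_right (sub_pos.2 hli)
      exact this.trans_le (Finset.single_le_sum (fun i _ => ha0 l i) (Finset.mem_univ _))
    have hAc : Continuous A := continuous_finsetSum _ fun i _ => hac i
    let w : (Fin N → ℝ) → t → ℝ := fun l i => a l i / A l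
    have hwS : ∀ l ∈ S, w l ∈ stdSimplex ℝ t := by
      intro l hl
      refine ⟨fun i => div_nonneg (ha0 l i) (hA0 l hl).le, ?_⟩
      simp only [w]
      rw [← Finset.sum_div]
      exact div_self (hA0 l hl).ne'
    have hwc : ContinuousOn w S := continuousOn_pi.2 fun i =>
      (hac i).continuousOn.div hAc.continuousOn fun l hl => (hA0 l hl).ne'
    let p : (Fin N → ℝ) → D := fun l => m (w l)
    have hpc : ContinuousOn p S := hmc.comp hwc hwS
    have hpmax : ∀ l ∈ S, ∀ q, W l q ≤ W l (p l) + ε := by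
      intro l hl q
      have hw := hwS l hl
      have h1 : ∑ i, w l i * W l (P i) ≤ W l (p l) := by
        simp only [W, Finset.mul_sum]
        rw [Finset.sum_comm]
        refine Finset.sum_le_sum fun j _ => ?_
        have := mul_le_mul_of_nonneg_left (hmV (w l) hw j j) (hl.1 j)
        refine le_trans (le_of_eq ?_) this
        rw [Finset.mul_sum]
        exact Finset.sum_congr rfl fun i _ => by ring
      have h2 : ∑ i, w l i * (W l q - ε) ≤ ∑ i, w l i * W l (P i) := by
        refine Finset.sum_le_sum fun i _ => ?_
        by_cases hd : dist l i < δ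
        · refine mul_le_mul_of_nonneg_left ?_ (hw.1 i)
          have e1 := hWlip l i q
          have e2 := hP i q
          have e3 := hWlip i l (P i)
          rw [dist_comm] at e3
          have e4 := mul_le_mul_of_nonneg_left hd.le hM0.le
          linarith
        · have : w l i = 0 := by
            simp only [w, a]
            rw [max_eq_left (by linarith), zero_div]
          simp [this]
      rw [← Finset.sum_mul, hw.2, one_mul] at h2
      linarith
    let φ : (Fin N → ℝ) → (Fin N → ℝ) := fun l j => (l j + f j (p l)) / (1 + Φ (p l))
    have hpos : ∀ q, 0 < 1 + Φ q := fun q => by linarith [hΦ0 q]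
    obtain ⟨l, hl, hfix⟩ := brouwer_simplex hN φ
      (continuousOn_pi.2 fun j => ((continuous_apply j).continuousOn.add
        ((hfc j).comp_continuousOn hpc)).div
        (continuousOn_const.add (hΦc.comp_continuousOn hpc)) fun l _ => (hpos _).ne')
      (by
        intro l hl
        refine ⟨fun j => div_nonneg (add_nonneg (hl.1 j) (hf0 _ _)) (hpos _).le, ?_⟩
        simp only [φ]
        rw [← Finset.sum_div, Finset.sum_add_distrib, hl.2]
        exact div_self (hpos _).ne')
    refine ⟨(l, p l), hl, hpmax l hl, fun j => ?_⟩
    have := congrFun hfix j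
    simp only [φ] at this
    rw [div_eq_iff (hpos _).ne'] at this
    simp only
    linarith
  -- limit
  obtain ⟨⟨l, p⟩, hlp⟩ : (⋂ n : ℕ, T (1 / ((n:ℝ) + 1))).Nonempty := by
    apply IsCompact.nonempty_iInter_of_sequence_nonempty_isCompact_isClosed
    · intro n z hz
      refine ⟨hz.1, fun q => (hz.2.1 q).trans ?_, hz.2.2⟩
      gcongr
      simp
    · intro n; exact hTne _ (by positivity)
    · refine (hSc.prod isCompact_univ).of_isClosed_subset (hTclosed _) ?_
      intro z hz
      exact ⟨hz.1, trivial⟩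
    · intro n; exact hTclosed _
  rw [Set.mem_iInter] at hlp
  have hl : l ∈ S := (hlp 0).1
  have hmax : ∀ q, W l q ≤ W l p := by
    intro q
    refine le_of_forall_pos_le_add fun ε hε => ?_
    obtain ⟨n, hn⟩ := exists_nat_one_div_lt hε
    exact ((hlp n).2.1 q).trans (by simp only; linarith)
  have hfix : ∀ j, f j p = l j * Φ p := (hlp 0).2.2
  have hlpos : ∃ j, 0 < l j := by
    by_contra h
    push Not at h
    have := Finset.sum_nonpos fun j (_ : j ∈ Finset.univ) => h j
    have h1 : ∑ j, l j = 1 := hl.2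
    linarith
  refine ⟨p, ?_, ?_⟩
  · rintro ⟨p', hp'⟩
    obtain ⟨j, hj⟩ := hlpos
    refine absurd (hmax p') (not_le.2 ?_)
    exact Finset.sum_lt_sum (fun i _ => mul_le_mul_of_nonneg_left (hp' i).le (hl.1 i))
      ⟨j, Finset.mem_univ j, mul_lt_mul_of_pos_left (hp' j) hj⟩
  · have hΦ : Φ p = 0 := by
      by_contra hne
      have hΦpos : 0 < Φ p := lt_of_le_of_ne (hΦ0 p) (Ne.symm hne)
      refine perm_contra l hl.1 (fun j k => V j k p) (fun σ => ?_) (fun j hj => ?_) hlpos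
      · obtain ⟨p', hp'⟩ := hperm σ p
        have := hmax p'
        simp only [W, hp'] at this
        exact this
      · have h1 : 0 < f j p := by rw [hfix]; positivity
        by_contra h
        push Not at h
        have : f j p = 0 := Finset.sum_eq_zero fun k _ => max_eq_left (by linarith [h k])
        linarith
    intro j k
    have h1 : f j p = 0 := by rw [hfix, hΦ, mul_zero]
    have h2 := (Finset.sum_eq_zero_iff_of_nonneg (fun k _ => le_max_left _ _)).1 h1 k
      (Finset.mem_univ k)
    have h3 := le_max_right 0 (V j k p - V j j p)
    rw [h2] at h3
    linarith

theorem jensen_prob {Y : Type*} [MeasurableSpace Y] (u : ProbabilityMeasure Y → ℝ)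
    (hu : ∀ (μ ν σ : ProbabilityMeasure Y) (t : ℝ≥0), t ≤ 1 →
      (σ : Measure Y) = t • (μ : Measure Y) + (1 - t) • (ν : Measure Y) →
      (t : ℝ) * u μ + (1 - (t : ℝ)) * u ν ≤ u σ)
    {ι : Type} (μ : ι → ProbabilityMeasure Y) (s : Finset ι) :
    ∀ (w : ι → ℝ≥0), ∑ i ∈ s, w i = 1 → ∀ σ : ProbabilityMeasure Y,
      (σ : Measure Y) = ∑ i ∈ s, w i • (μ i : Measure Y) →
      ∑ i ∈ s, (w i : ℝ) * u (μ i) ≤ u σ := by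
  classical
  induction s using Finset.induction_on with
  | empty => intro w hw; simp at hw
  | insert a s ha ih =>
    intro w hw σ hσ
    rw [Finset.sum_insert ha] at hw hσ ⊢
    have hle : w a ≤ 1 := by rw [← hw]; exact le_self_add
    have hc : ∑ i ∈ s, w i = 1 - w a := by rw [← hw, add_tsub_cancel_left]
    by_cases h0 : ∑ i ∈ s, w i = 0
    · have hz : ∀ i ∈ s, w i = 0 := fun i hi => (Finset.sum_eq_zero_iff.1 h0) i hi
      have hwa : w a = 1 := by rw [h0, add_zero] at hw; exact hw
      have e1 : ∑ i ∈ s, (w i : ℝ) * u (μ i) = 0 :=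
        Finset.sum_eq_zero fun i hi => by simp [hz i hi]
      have e2 : ∑ i ∈ s, w i • (μ i : Measure Y) = 0 :=
        Finset.sum_eq_zero fun i hi => by simp [hz i hi]
      rw [e2, hwa, one_smul, add_zero] at hσ
      have : σ = μ a := Subtype.ext hσ
      rw [e1, hwa, this]; simp
    · set c := ∑ i ∈ s, w i with hcdef
      have hmass : ∑ i ∈ s, (w i / c) = 1 := by rw [← Finset.sum_div]; exact div_self h0
      let τ : ProbabilityMeasure Y := ⟨∑ i ∈ s, (w i / c) • (μ i : Measure Y), ⟨by
        rw [Measure.finsetSum_apply]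
        simp only [Measure.smul_apply, measure_univ]
        have : ((∑ i ∈ s, (w i / c) : ℝ≥0) : ENNReal) = 1 := by rw [hmass]; simp
        refine Eq.trans ?_ this
        rw [ENNReal.coe_finsetSum]
        simp [ENNReal.smul_def]⟩⟩
      have h1 := ih (fun i => w i / c) hmass τ rfl
      have hτ : c • (τ : Measure Y) = ∑ i ∈ s, w i • (μ i : Measure Y) := by
        change c • (∑ i ∈ s, (w i / c) • (μ i : Measure Y)) = _
        rw [Finset.smul_sum]
        refine Finset.sum_congr rfl fun i _ => ?_
        rw [smul_smul, mul_div_cancel₀ _ h0]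
      have h2 := hu (μ a) τ σ (w a) hle (by rw [hσ, ← hτ, hc])
      have hcR : (1 - (w a : ℝ)) = (c : ℝ) := by rw [hc, NNReal.coe_sub hle]; simp
      rw [hcR] at h2
      have h3 : ∑ i ∈ s, (w i : ℝ) * u (μ i) = c * ∑ i ∈ s, ((w i / c : ℝ≥0) : ℝ) * u (μ i) := by
        rw [Finset.mul_sum]
        refine Finset.sum_congr rfl fun i _ => ?_
        have : (c : ℝ) ≠ 0 := by exact_mod_cast h0
        push_cast
        field_simp
      rw [h3]
      have := mul_le_mul_of_nonneg_left h1 c.2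
      exact le_trans (by simpa using this) h2

theorem borel_of_compact {Y : Type*} [TopologicalSpace Y] [TopologicalSpace.MetrizableSpace Y]
    [MeasurableSpace Y] [BorelSpace Y] {N : ℕ} (X : Set (Fin N → Y)) (hX : IsCompact X) :
    BorelSpace X := by
  let K : Set Y := ⋃ j : Fin N, (fun x : Fin N → Y => x j) '' X
  have hK : IsCompact K := isCompact_iUnion fun j => hX.image (continuous_apply j)
  have : CompactSpace K := isCompact_iff_compactSpace.1 hK
  letI : MetricSpace K := TopologicalSpace.metrizableSpaceMetric K
  have : SecondCountableTopology K := inferInstance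
  let e : X → (Fin N → K) := fun x j => ⟨(x : Fin N → Y) j, Set.mem_iUnion.2 ⟨j, x, x.2, rfl⟩⟩
  have hem : Measurable e := measurable_pi_iff.2 fun j =>
    Measurable.subtype_mk ((measurable_pi_apply j).comp measurable_subtype_coe)
  have hind : Topology.IsInducing e := by
    have h1 : Continuous e := continuous_pi fun j =>
      Continuous.subtype_mk ((continuous_apply j).comp continuous_subtype_val) _
    have h2 : Continuous fun (y : Fin N → K) (j : Fin N) => (y j : Y) := by fun_prop
    exact Topology.IsInducing.of_comp h1 h2 Topology.IsInducing.subtypeVal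
  constructor
  apply le_antisymm
  · let _ : MeasurableSpace X := borel X
    have : BorelSpace X := ⟨rfl⟩
    have : Measurable (fun x : X => (x : Fin N → Y)) := measurable_pi_iff.2 fun j =>
      ((continuous_apply j).comp continuous_subtype_val).measurable
    exact this.comap_le
  · refine MeasurableSpace.generateFrom_le fun O hO => ?_
    obtain ⟨O', hO', rfl⟩ := hind.isOpen_iff.1 hO
    exact hem hO'.measurableSet

/-- **Existence theorem.**  In the general allocation setting — `Y`
metrizable, `X ⊆ Y^N` a nonempty compact permutation-invariant set of deterministic
allocations, and each agent `j` having a continuous concave utility `U_j : Δ(Y) → ℝ`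
evaluated at the `j`-th marginal — there exists a random allocation `p ∈ Δ(X)` that is
weakly Pareto efficient and envy-free. -/
theorem stmt4 {Y : Type*} [TopologicalSpace Y] [TopologicalSpace.MetrizableSpace Y]
    [MeasurableSpace Y] [BorelSpace Y]
    (N : ℕ) (hN : 1 ≤ N) (X : Set (Fin N → Y)) (hXne : X.Nonempty) (hXcomp : IsCompact X)
    (hXswap : ∀ i j : Fin N, ∀ x ∈ X, x ∘ Equiv.swap i j ∈ X)
    (U : Fin N → ProbabilityMeasure Y → ℝ)
    (hUcont : ∀ j, Continuous (U j))
    (hUconc : ∀ (j : Fin N) (μ ν σ : ProbabilityMeasure Y) (t : ℝ≥0), t ≤ 1 →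
      (σ : Measure Y) = t • (μ : Measure Y) + (1 - t) • (ν : Measure Y) →
      (t : ℝ) * U j μ + (1 - (t : ℝ)) * U j ν ≤ U j σ) :
    ∃ p : ProbabilityMeasure ↥X,
      (¬ ∃ p' : ProbabilityMeasure ↥X, ∀ j : Fin N,
        U j (marginal p j) < U j (marginal p' j)) ∧
      (∀ j k : Fin N, U j (marginal p k) ≤ U j (marginal p j)) := by
  classical
  have hbor : BorelSpace X := borel_of_compact X hXcomp
  have hcs : CompactSpace X := isCompact_iff_compactSpace.1 hXcomp
  have hne : Nonempty X := hXne.to_subtype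
  obtain ⟨x0⟩ := id hne
  let p0 : ProbabilityMeasure X := ⟨Measure.dirac x0, inferInstance⟩
  have hneD : Nonempty (ProbabilityMeasure X) := ⟨p0⟩
  have hperm : ∀ (σ : Equiv.Perm (Fin N)), ∀ x ∈ X, x ∘ σ ∈ X := by
    intro σ
    induction σ using Equiv.Perm.swap_induction_on with
    | one => intro x hx; exact hx
    | swap_mul σ a b _ ih =>
      intro x hx
      exact ih _ (hXswap a b x hx)
  have hcoord : ∀ k : Fin N, Continuous fun x : X => (x : Fin N → Y) k := fun k =>
    (continuous_apply k).comp continuous_subtype_val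
  have hmc : ∀ k : Fin N, Continuous fun p : ProbabilityMeasure X => marginal p k := fun k =>
    ProbabilityMeasure.continuous_map (hcoord k)
  refine abstract_existence hN (fun j k p => U j (marginal p k))
    (fun j k => (hUcont j).comp (hmc k)) ?_ ?_
  · intro σ p
    let T : X → X := fun x => ⟨(x : Fin N → Y) ∘ σ, hperm σ x x.2⟩
    have hT : Measurable T := by
      refine Measurable.subtype_mk (measurable_pi_iff.2 fun j => ?_)
      exact (measurable_pi_apply (σ j)).comp measurable_subtype_coe
    refine ⟨p.map hT.aemeasurable, fun j k => ?_⟩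
    congr 1
    apply Subtype.ext
    change ((p : Measure X).map T).map (fun x : X => (x : Fin N → Y) k) =
      (p : Measure X).map (fun x : X => (x : Fin N → Y) (σ k))
    rw [Measure.map_map (hcoord k).measurable hT]
    rfl
  · intro ι _ p
    let mm : (ι → ℝ) → Measure X := fun w => ∑ i, (w i).toNNReal • (p i : Measure X)
    have hsum : ∀ w ∈ stdSimplex ℝ ι, ∑ i, (w i).toNNReal = 1 := by
      intro w hw
      rw [← Real.toNNReal_sum_of_nonneg fun i _ => hw.1 i, hw.2, Real.toNNReal_one]
    have hprob : ∀ w ∈ stdSimplex ℝ ι, IsProbabilityMeasure (mm w) := by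
      intro w hw
      constructor
      simp only [mm]
      rw [Measure.finsetSum_apply]
      simp only [Measure.smul_apply, measure_univ]
      have : ((∑ i, (w i).toNNReal : ℝ≥0) : ENNReal) = 1 := by rw [hsum w hw]; simp
      refine Eq.trans ?_ this
      rw [ENNReal.coe_finsetSum]
      simp [ENNReal.smul_def]
    let m : (ι → ℝ) → ProbabilityMeasure X := fun w =>
      if h : w ∈ stdSimplex ℝ ι then ⟨mm w, hprob w h⟩ else p0
    have hm : ∀ w ∈ stdSimplex ℝ ι, ((m w : ProbabilityMeasure X) : Measure X) = mm w := by
      intro w hw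
      simp [m, hw]
    refine ⟨m, ?_, ?_⟩
    · intro w0 hw0
      refine ProbabilityMeasure.tendsto_iff_forall_integral_tendsto.2 fun f => ?_
      have hI : ∀ w ∈ stdSimplex ℝ ι, ∫ x, f x ∂(m w : Measure X) =
          ∑ i, w i * ∫ x, f x ∂(p i : Measure X) := by
        intro w hw
        rw [hm w hw]
        simp only [mm]
        rw [integral_finsetSum_measure]
        · refine Finset.sum_congr rfl fun i _ => ?_
          rw [integral_smul_nnreal_measure, NNReal.smul_def, Real.coe_toNNReal _ (hw.1 i),
            smul_eq_mul]
        · intro i _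
          exact (f.integrable (p i : Measure X)).smul_measure_nnreal
      rw [hI w0 hw0]
      have hc : Continuous fun w : ι → ℝ => ∑ i, w i * ∫ x, f x ∂(p i : Measure X) := by fun_prop
      refine (hc.continuousWithinAt (s := stdSimplex ℝ ι) (x := w0)).congr' ?_
      filter_upwards [self_mem_nhdsWithin] with w hw
      exact (hI w hw).symm
    · intro w hw j k
      have := jensen_prob (U j) (hUconc j) (fun i => marginal (p i) k) Finset.univ
        (fun i => (w i).toNNReal) (hsum w hw) (marginal (m w) k) (by
          change (m w : Measure X).map (fun x : X => (x : Fin N → Y) k) =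
            ∑ i, (w i).toNNReal • (p i : Measure X).map (fun x : X => (x : Fin N → Y) k)
          rw [hm w hw]
          ext A hA
          rw [Measure.map_apply (hcoord k).measurable hA]
          simp only [mm]
          rw [Measure.finsetSum_apply, Measure.finsetSum_apply]
          refine Finset.sum_congr rfl fun i _ => ?_
          rw [Measure.smul_apply, Measure.smul_apply, Measure.map_apply (hcoord k).measurable hA])
      refine le_trans (le_of_eq ?_) this
      refine Finset.sum_congr rfl fun i _ => ?_
      rw [Real.coe_toNNReal _ (hw.1 i)]
end

section
/- There exists a measurable partition (E_1,…,E_N) of L such that: (i) envy-freeness: μ_j(E_j) ≥ μ_j(E_k) for all j,k ∈ {1,…,N}; and (ii) weak Pareto efficiency: there is no partition of unity (g_1,…,g_N) with ∫ g_j dμ_j > μ_j(E_j) for every j. -/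
open MeasureTheory

open Filter Topology in
lemma aux_split_one {L : Type*} [MeasurableSpace L] (ν : Measure L)
    (φ : L → ℝ) (hφ : Measurable φ) (a b : ℝ) (hb : ∀ x, φ x ∈ Set.Ioo a b)
    (hν : ∀ t, ν (φ ⁻¹' {t}) = 0) (p : L → ℝ) (hp : Integrable p ν)
    (T : Set L) (hT : MeasurableSet T) (c : ℝ) (hc0 : 0 ≤ c) (hc : c ≤ ∫ x in T, p x ∂ν) :
    ∃ A ⊆ T, MeasurableSet A ∧ ∫ x in A, p x ∂ν = c := by
  have hm : ∀ t, MeasurableSet (T ∩ φ ⁻¹' Set.Iic t) := fun t => hT.inter (hφ measurableSet_Iic)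
  let F : ℝ → ℝ := fun t => ∫ x, (T ∩ φ ⁻¹' Set.Iic t).indicator p x ∂ν
  have hF : Continuous F := by
    rw [continuous_iff_continuousAt]
    intro t0
    apply continuousAt_of_dominated (bound := fun x => ‖p x‖)
    · exact Eventually.of_forall fun t => (hp.1.indicator (hm t))
    · exact Eventually.of_forall fun t => Eventually.of_forall fun x => norm_indicator_le_norm_self _ _
    · exact hp.norm
    · have : ∀ᵐ x ∂ν, x ∉ φ ⁻¹' {t0} := measure_eq_zero_iff_ae_notMem.1 (hν t0)
      filter_upwards [this] with x hx
      have hx : φ x ≠ t0 := hx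
      rcases lt_or_gt_of_ne hx with h | h
      · have : (fun t => (T ∩ φ ⁻¹' Set.Iic t).indicator p x) =ᶠ[𝓝 t0] fun _ => T.indicator p x := by
          filter_upwards [lt_mem_nhds h] with t ht
          by_cases hxT : x ∈ T <;> simp [Set.indicator, hxT, ht.le]
        exact (continuousAt_const).congr this.symm
      · have : (fun t => (T ∩ φ ⁻¹' Set.Iic t).indicator p x) =ᶠ[𝓝 t0] fun _ => 0 := by
          filter_upwards [gt_mem_nhds h] with t ht
          simp [Set.indicator, ht]
        exact (continuousAt_const).congr this.symm
  have hFe : ∀ t, F t = ∫ x in T ∩ φ ⁻¹' Set.Iic t, p x ∂ν := fun t => integral_indicator (hm t)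
  have hFa : F a = 0 := by
    rw [hFe]
    have : T ∩ φ ⁻¹' Set.Iic a = ∅ := by
      ext x; simp; intro _; exact (hb x).1
    simp [this]
  have hFb : F b = ∫ x in T, p x ∂ν := by
    rw [hFe]
    have : T ∩ φ ⁻¹' Set.Iic b = T := by
      ext x; simp; intro _; exact (hb x).2.le
    rw [this]
  obtain ⟨t, ht⟩ := mem_range_of_exists_le_of_exists_ge hF ⟨a, hFa.le.trans hc0⟩ ⟨b, hc.trans hFb.ge⟩
  exact ⟨_, Set.inter_subset_left, hm t, by rw [← hFe, ht]⟩

lemma aux_split {L : Type*} [MeasurableSpace L] (ν : Measure L)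
    (φ : L → ℝ) (hφ : Measurable φ) (a b : ℝ) (hb : ∀ x, φ x ∈ Set.Ioo a b)
    (hν : ∀ t, ν (φ ⁻¹' {t}) = 0) (p : L → ℝ) (hp : Integrable p ν)
    {ι : Type*} [DecidableEq ι] (s : Finset ι) (hs : s.Nonempty) (c : ι → ℝ) (hc : ∀ i, 0 ≤ c i) :
    ∀ (T : Set L), MeasurableSet T → ∑ i ∈ s, c i = ∫ x in T, p x ∂ν →
    ∃ E : ι → Set L, (∀ i ∈ s, MeasurableSet (E i)) ∧ (∀ i ∈ s, ∀ j ∈ s, i ≠ j → Disjoint (E i) (E j)) ∧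
      (⋃ i ∈ s, E i) = T ∧ ∀ i ∈ s, ∫ x in E i, p x ∂ν = c i := by
  induction hs using Finset.Nonempty.cons_induction with
  | singleton i =>
    intro T hT h
    refine ⟨fun _ => T, ?_, ?_, ?_, ?_⟩
    · simp [hT]
    · intro i hi j hj hij; simp at hi hj; exact absurd (hi.trans hj.symm) hij
    · simp
    · simpa using h.symm
  | cons i s his hs ih =>
    intro T hT h
    rw [Finset.sum_cons] at h
    obtain ⟨A, hAT, hA, hAc⟩ := aux_split_one ν φ hφ a b hb hν p hp T hT (c i) (hc i)
      (by rw [← h]; linarith [Finset.sum_nonneg (s := s) (fun i _ => hc i)])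
    have hdiff := setIntegral_sdiff hA (hp.integrableOn (s := T)) hAT
    obtain ⟨E, h1, h2, h3, h4⟩ := ih (T \ A) (hT.diff hA) (by rw [hdiff, hAc, ← h]; ring)
    have hne : ∀ j ∈ s, j ≠ i := fun j hj e => his (e ▸ hj)
    have hsub : ∀ j ∈ s, E j ⊆ T \ A := fun j hj => h3 ▸ Set.subset_biUnion_of_mem (u := E) hj
    have hdis : ∀ j ∈ s, Disjoint A (E j) := fun j hj =>
      (Set.disjoint_sdiff_right).mono_right (hsub j hj)
    refine ⟨Function.update E i A, ?_, ?_, ?_, ?_⟩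
    · intro j hj
      rcases Finset.mem_cons.1 hj with rfl | hj
      · simpa using hA
      · rw [Function.update_of_ne (hne j hj)]; exact h1 j hj
    · intro j hj k hk hjk
      rcases Finset.mem_cons.1 hj with hji | hjs <;> rcases Finset.mem_cons.1 hk with hki | hks
      · exact absurd (hji.trans hki.symm) hjk
      · subst hji; rw [Function.update_of_ne (hne k hks)]; simpa using hdis k hks
      · subst hki; rw [Function.update_of_ne (hne j hjs)]; simpa using (hdis j hjs).symm
      · rw [Function.update_of_ne (hne k hks), Function.update_of_ne (hne j hjs)]
        exact h2 j hjs k hks hjk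
    · have : (⋃ j ∈ s, Function.update E i A j) = T \ A := by
        rw [← h3]
        exact Set.iUnion₂_congr fun j hj => by rw [Function.update_of_ne (hne j hj)]
      simp only [Finset.mem_cons, Set.iUnion_iUnion_eq_or_left, Function.update_self, this]
      exact Set.union_sdiff_cancel hAT
    · intro j hj
      rcases Finset.mem_cons.1 hj with rfl | hj
      · simpa using hAc
      · rw [Function.update_of_ne (hne j hj)]; exact h4 j hj

lemma aux_phi (L : Type*) [MetricSpace L] [TopologicalSpace.SeparableSpace L]
    [MeasurableSpace L] [BorelSpace L] : ∃ (φ : L → ℝ) (a b : ℝ), Measurable φ ∧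
      Function.Injective φ ∧ ∀ x, φ x ∈ Set.Ioo a b := by
  have := UniformSpace.secondCountable_of_separable L
  obtain ⟨f, hf, hfi⟩ := MeasurableSpace.measurable_injection_nat_bool_of_countablySeparated L
  obtain ⟨g, hg⟩ := exists_measurableEmbedding_real (ℕ → Bool)
  refine ⟨fun x => Real.arctan (g (f x)), _, _, Real.measurable_arctan.comp (hg.measurable.comp hf), ?_, fun x => Real.arctan_mem_Ioo _⟩
  exact Real.arctan_injective.comp (hg.injective.comp hfi)

open Filter Topology in
lemma aux_loss {L : Type*} [MeasurableSpace L] (ν : Measure L) (p l : L → ℝ)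
    (hp : Integrable p ν) (hpm : Measurable p) (hp0 : ∀ x, 0 ≤ p x)
    (hl : Integrable l ν) (hlm : Measurable l) (hl0 : ∀ x, 0 ≤ l x)
    (g : ℕ → L → ℝ) (hg : ∀ n, Measurable (g n)) (hg1 : ∀ n x, g n x ∈ Set.Icc (0:ℝ) 1)
    (hlim : Tendsto (fun n => ∫ x, g n x * l x ∂ν) atTop (𝓝 0))
    (T : Set L) (hT : MeasurableSet T) (hTl : ∀ x ∈ T, l x ≠ 0) :
    Tendsto (fun n => ∫ x in T, g n x * p x ∂ν) atTop (𝓝 0) := by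
  have hbd : ∀ n, ∀ q : L → ℝ, Integrable q ν → Integrable (fun x => g n x * q x) ν := by
    intro n q hq
    refine hq.bdd_mul (c := 1) (hg n).aestronglyMeasurable (Eventually.of_forall fun x => ?_)
    rw [Real.norm_eq_abs, abs_of_nonneg (hg1 n x).1]; exact (hg1 n x).2
  let R : ℕ → L → ℝ := fun K => T.indicator (fun x => max (p x - K * l x) 0)
  have hRm : ∀ K, Measurable (R K) := fun K =>
    ((hpm.sub (hlm.const_mul _)).max measurable_const).indicator hT
  have hRb : ∀ K x, ‖R K x‖ ≤ p x := by
    intro K x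
    by_cases hx : x ∈ T
    · simp only [R, Set.indicator_of_mem hx]
      rw [Real.norm_eq_abs, abs_of_nonneg (le_max_right _ _)]
      have : 0 ≤ (K:ℝ) * l x := mul_nonneg (Nat.cast_nonneg _) (hl0 x)
      exact max_le (by linarith) (hp0 x)
    · simp [R, hx, hp0 x]
  have hRi : ∀ K, Integrable (R K) ν := fun K =>
    hp.mono' (hRm K).aestronglyMeasurable (Eventually.of_forall (hRb K))
  have hR : Tendsto (fun K => ∫ x, R K x ∂ν) atTop (𝓝 (∫ x, (0:ℝ) ∂ν)) := by
    apply tendsto_integral_of_dominated_convergence p (fun K => (hRm K).aestronglyMeasurable) hp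
      (fun K => Eventually.of_forall (hRb K))
    refine Eventually.of_forall fun x => ?_
    by_cases hx : x ∈ T
    · have hlx : 0 < l x := lt_of_le_of_ne (hl0 x) (hTl x hx).symm
      obtain ⟨K0, hK0⟩ := exists_nat_gt (p x / l x)
      apply tendsto_const_nhds.congr'
      filter_upwards [eventually_ge_atTop K0] with K hK
      simp only [R, Set.indicator_of_mem hx]
      symm; apply max_eq_right
      have : p x / l x ≤ K := hK0.le.trans (by exact_mod_cast hK)
      rw [div_le_iff₀ hlx] at this
      linarith
    · simp [R, hx]
  rw [integral_zero] at hR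
  have hnn : ∀ n, 0 ≤ ∫ x in T, g n x * p x ∂ν := fun n =>
    integral_nonneg fun x => mul_nonneg (hg1 n x).1 (hp0 x)
  have key : ∀ (K : ℕ) n, ∫ x in T, g n x * p x ∂ν ≤ K * ∫ x, g n x * l x ∂ν + ∫ x, R K x ∂ν := by
    intro K n
    rw [← integral_indicator hT, ← integral_const_mul, ← integral_add ((hbd n l hl).const_mul _) (hRi K)]
    apply integral_mono ((hbd n p hp).indicator hT) (((hbd n l hl).const_mul _).add (hRi K))
    intro x
    have h1 := (hg1 n x).1
    have h2 := (hg1 n x).2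
    by_cases hx : x ∈ T
    · simp only [R, Set.indicator_of_mem hx, Pi.add_apply]
      have h3 := le_max_left (p x - K * l x) 0
      have h4 := le_max_right (p x - K * l x) 0
      nlinarith
    · simp only [R, Set.indicator_of_notMem hx, Pi.add_apply]
      have := mul_nonneg (Nat.cast_nonneg K : (0:ℝ) ≤ K) (mul_nonneg h1 (hl0 x))
      linarith
  rw [Metric.tendsto_atTop]
  intro ε hε
  obtain ⟨K, hK⟩ := ((tendsto_order.1 hR).2 (ε/2) (by linarith)).exists
  have h0 : Tendsto (fun n => (K:ℝ) * ∫ x, g n x * l x ∂ν) atTop (𝓝 0) := by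
    simpa using hlim.const_mul (K:ℝ)
  obtain ⟨M, hM⟩ := eventually_atTop.1 ((tendsto_order.1 h0).2 (ε/2) (by linarith))
  refine ⟨M, fun n hn => ?_⟩
  rw [Real.dist_eq, sub_zero, abs_of_nonneg (hnn n)]
  linarith [key K n, hM n hn]

open Filter Topology in
lemma aux_foc {N : ℕ} (U : Set (Fin N → ℝ)) (hU : Convex ℝ U) (u : Fin N → ℝ) (hu : u ∈ U)
    (hpos : ∀ j, 0 < u j) (hmax : ∀ v ∈ U, ∏ j, v j ≤ ∏ j, u j) (v : Fin N → ℝ) (hv : v ∈ U)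
    (hv0 : ∀ j, 0 ≤ v j) : ∑ j, v j / u j ≤ N := by
  have h1 : ∀ t ∈ Set.Ioo (0:ℝ) 1, ∑ j, (v j / u j - 1) / (1 + t * (v j / u j - 1)) ≤ 0 := by
    intro t ht
    have hmem : (1 - t) • u + t • v ∈ U := hU hu hv (by linarith [ht.2]) ht.1.le (by ring)
    have hpos' : ∀ j, 0 < 1 + t * (v j / u j - 1) := fun j => by
      have := mul_nonneg ht.1.le (div_nonneg (hv0 j) (hpos j).le)
      linarith [ht.2]
    have h2 := hmax _ hmem
    have h3 : ∏ j, ((1 - t) • u + t • v) j = (∏ j, u j) * ∏ j, (1 + t * (v j / u j - 1)) := by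
      rw [← Finset.prod_mul_distrib]
      refine Finset.prod_congr rfl fun j _ => ?_
      have := (hpos j).ne'
      simp; field_simp; ring
    rw [h3] at h2
    have hup : 0 < ∏ j, u j := Finset.prod_pos fun j _ => hpos j
    have h4 : ∏ j, (1 + t * (v j / u j - 1)) ≤ 1 := by
      by_contra h; push Not at h; nlinarith
    have h5 : ∑ j, Real.log (1 + t * (v j / u j - 1)) ≤ 0 := by
      rw [← Real.log_prod (fun j _ => (hpos' j).ne')]
      exact Real.log_nonpos (Finset.prod_nonneg fun j _ => (hpos' j).le) h4
    have h6 : t * ∑ j, (v j / u j - 1) / (1 + t * (v j / u j - 1)) ≤ 0 := by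
      refine le_trans ?_ h5
      rw [Finset.mul_sum]
      refine Finset.sum_le_sum fun j _ => le_trans (le_of_eq ?_) (Real.one_sub_inv_le_log_of_pos (hpos' j))
      have := (hpos' j).ne'
      generalize v j / u j - 1 = y at *
      field_simp; ring
    by_contra h; push Not at h
    nlinarith [ht.1, mul_pos ht.1 h]
  have h2 : Tendsto (fun t : ℝ => ∑ j, (v j / u j - 1) / (1 + t * (v j / u j - 1))) (𝓝[>] 0)
      (𝓝 (∑ j, (v j / u j - 1) / (1 + 0 * (v j / u j - 1)))) := by
    apply tendsto_finsetSum
    intro j _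
    have : ContinuousAt (fun t : ℝ => (v j / u j - 1) / (1 + t * (v j / u j - 1))) 0 := by
      apply ContinuousAt.div₀ <;> first | fun_prop | simp
    exact this.tendsto.mono_left nhdsWithin_le_nhds
  have h3 := le_of_tendsto h2 (by
    filter_upwards [Ioo_mem_nhdsGT (show (0:ℝ) < 1 by norm_num)] with t ht using h1 t ht)
  simpa using h3

open Filter Topology in
lemma aux_equil {L : Type*} [MeasurableSpace L] (ν : Measure L)
    (φ : L → ℝ) (hφ : Measurable φ) (a b : ℝ) (hb : ∀ x, φ x ∈ Set.Ioo a b)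
    (hν : ∀ t, ν (φ ⁻¹' {t}) = 0) {N : ℕ} (hN : 1 ≤ N)
    (h : Fin N → L → ℝ) (hm : ∀ j, Measurable (h j)) (h0 : ∀ j x, 0 ≤ h j x)
    (hi : ∀ j, Integrable (h j) ν)
    (p : L → ℝ) (hp : Integrable p ν) (hpm : Measurable p) (hle : ∀ j x, h j x ≤ p x)
    (hpN : ∫ x, p x ∂ν ≤ N)
    (g : ℕ → Fin N → L → ℝ) (hg : ∀ n j, Measurable (g n j))
    (hg1 : ∀ n j x, g n j x ∈ Set.Icc (0:ℝ) 1) (hgs : ∀ n x, ∑ j, g n j x = 1)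
    (hlim : ∀ j, Tendsto (fun n => ∫ x, g n j x * h j x ∂ν) atTop (𝓝 1)) :
    ∃ E : Fin N → Set L, (∀ j, MeasurableSet (E j)) ∧
      (∀ j k : Fin N, j ≠ k → Disjoint (E j) (E k)) ∧
      ((⋃ j, E j) = Set.univ) ∧ (∀ j, ∫ x in E j, p x ∂ν = 1) ∧ (∀ j, ∫ x in E j, h j x ∂ν = 1) := by
  classical
  have hbd : ∀ n j, ∀ q : L → ℝ, Integrable q ν → Integrable (fun x => g n j x * q x) ν := by
    intro n j q hq
    refine hq.bdd_mul (c := 1) (hg n j).aestronglyMeasurable (Eventually.of_forall fun x => ?_)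
    rw [Real.norm_eq_abs, abs_of_nonneg (hg1 n j x).1]; exact (hg1 n j x).2
  have hp0 : ∀ x, 0 ≤ p x := fun x => (h0 ⟨0, hN⟩ x).trans (hle _ x)
  have hlnn : ∀ n j, 0 ≤ ∫ x, g n j x * (p x - h j x) ∂ν := fun n j =>
    integral_nonneg fun x => mul_nonneg (hg1 n j x).1 (sub_nonneg.2 (hle j x))
  have hls : ∀ n j, ∫ x, g n j x * (p x - h j x) ∂ν
      = ∫ x, g n j x * p x ∂ν - ∫ x, g n j x * h j x ∂ν := by
    intro n j
    rw [← integral_sub (hbd n j p hp) (hbd n j _ (hi j))]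
    simp only [mul_sub]
  have hsump : ∀ n (T : Set L), ∑ j, ∫ x in T, g n j x * p x ∂ν = ∫ x in T, p x ∂ν := by
    intro n T
    rw [← integral_finsetSum _ (fun j _ => (hbd n j p hp).integrableOn)]
    simp only [← Finset.sum_mul, hgs, one_mul]
  have hloss : ∀ j, Tendsto (fun n => ∫ x, g n j x * (p x - h j x) ∂ν) atTop (𝓝 0) := by
    intro j
    have hub : Tendsto (fun n => (N:ℝ) - ∑ k, ∫ x, g n k x * h k x ∂ν) atTop (𝓝 0) := by
      have := (tendsto_finsetSum Finset.univ (fun k _ => hlim k)).const_sub (N:ℝ)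
      simpa using this
    refine squeeze_zero (fun n => hlnn n j) (fun n => ?_) hub
    calc _ ≤ ∑ k, ∫ x, g n k x * (p x - h k x) ∂ν :=
          Finset.single_le_sum (f := fun k => ∫ x, g n k x * (p x - h k x) ∂ν)
            (fun k _ => hlnn n k) (Finset.mem_univ j)
      _ ≤ _ := by
          simp only [hls, Finset.sum_sub_distrib]
          have := hsump n Set.univ
          simp only [setIntegral_univ] at this
          rw [this]; linarith
  have hlimp : ∀ j, Tendsto (fun n => ∫ x, g n j x * p x ∂ν) atTop (𝓝 1) := by
    intro j
    have := (hloss j).add (hlim j)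
    simpa [hls] using this
  let T : Finset (Fin N) → Set L := fun S => {x | ∀ j, j ∈ S ↔ h j x = p x}
  have hT : ∀ S, MeasurableSet (T S) := by
    intro S
    have : T S = ⋂ j, {x | j ∈ S ↔ h j x = p x} := by ext x; simp [T]
    rw [this]
    refine MeasurableSet.iInter fun j => ?_
    have h1 : MeasurableSet {x | h j x = p x} := measurableSet_eq_fun (hm j) hpm
    by_cases hj : j ∈ S
    · simpa [hj] using h1
    · have h2 : {x | j ∈ S ↔ h j x = p x} = {x | h j x = p x}ᶜ := by ext x; simp [hj]
      rw [h2]; exact h1.compl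
  have hTd : Pairwise (Function.onFun Disjoint T) := by
    intro S S' hne
    rw [Function.onFun, Set.disjoint_left]
    intro x hx hx'
    exact hne (by ext j; rw [hx j, hx' j])
  have hTu : (⋃ S, T S) = Set.univ := by
    ext x
    simp only [Set.mem_iUnion, Set.mem_univ, iff_true]
    exact ⟨Finset.univ.filter fun j => h j x = p x, fun j => by simp⟩
  let c : ℕ → (Finset (Fin N) → Fin N → ℝ) := fun n S j => ∫ x in T S, g n j x * p x ∂ν
  have hc0 : ∀ n S j, 0 ≤ c n S j := fun n S j =>
    integral_nonneg fun x => mul_nonneg (hg1 n j x).1 (hp0 x)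
  have hc1 : ∀ n S j, c n S j ≤ ∫ x in T S, p x ∂ν := fun n S j => by
    rw [← hsump n (T S)]
    exact Finset.single_le_sum (f := fun j => c n S j) (fun k _ => hc0 n S k) (Finset.mem_univ j)
  obtain ⟨d, -, ψ, hψ, hd⟩ := (isCompact_Icc (a := (0 : Finset (Fin N) → Fin N → ℝ))
    (b := fun S _ => ∫ x in T S, p x ∂ν)).tendsto_subseq (x := c)
    (fun n => ⟨fun S j => hc0 n S j, fun S j => hc1 n S j⟩)
  have hd' : ∀ S j, Tendsto (fun n => c (ψ n) S j) atTop (𝓝 (d S j)) := fun S j =>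
    tendsto_pi_nhds.1 (tendsto_pi_nhds.1 hd S) j
  have hd0 : ∀ S j, 0 ≤ d S j := fun S j => ge_of_tendsto' (hd' S j) fun n => hc0 _ S j
  have hdS : ∀ S, ∑ j, d S j = ∫ x in T S, p x ∂ν := by
    intro S
    have h1 := tendsto_finsetSum Finset.univ (fun j _ => hd' S j)
    exact tendsto_nhds_unique h1 (tendsto_const_nhds.congr fun n => (hsump (ψ n) (T S)).symm)
  have hdz : ∀ S j, j ∉ S → d S j = 0 := by
    intro S j hj
    have h1 := aux_loss ν p (fun x => p x - h j x) hp hpm hp0 (hp.sub (hi j)) (hpm.sub (hm j))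
      (fun x => sub_nonneg.2 (hle j x)) (fun n => g n j) (fun n => hg n j) (fun n => hg1 n j)
      (hloss j) (T S) (hT S) (fun x hx he => hj ((hx j).2 (by linarith)))
    exact tendsto_nhds_unique (hd' S j) (h1.comp hψ.tendsto_atTop)
  have hd1 : ∀ j, ∑ S, d S j = 1 := by
    intro j
    have h1 := tendsto_finsetSum Finset.univ (fun S _ => hd' S j)
    refine tendsto_nhds_unique h1 (((hlimp j).comp hψ.tendsto_atTop).congr fun n => ?_)
    simp only [Function.comp, c]
    rw [← integral_iUnion_fintype hT hTd (fun S => (hbd _ j p hp).integrableOn), hTu,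
      setIntegral_univ]
  have hne : (Finset.univ : Finset (Fin N)).Nonempty := ⟨⟨0, hN⟩, Finset.mem_univ _⟩
  choose E hE1 hE2 hE3 hE4 using fun S => aux_split ν φ hφ a b hb hν p hp Finset.univ hne (d S)
    (hd0 S) (T S) (hT S) (hdS S)
  have hsub : ∀ S j, E S j ⊆ T S := fun S j => by
    conv_rhs => rw [← hE3 S]
    exact Set.subset_biUnion_of_mem (u := E S) (Finset.mem_univ j)
  have hEd : ∀ j, Pairwise (Function.onFun Disjoint fun S => E S j) := fun j S S' hS =>
    (hTd hS).mono (hsub S j) (hsub S' j)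
  have hEm : ∀ S j, MeasurableSet (E S j) := fun S j => hE1 S j (Finset.mem_univ j)
  have hEh : ∀ S j, ∫ x in E S j, h j x ∂ν = d S j := by
    intro S j
    by_cases hj : j ∈ S
    · rw [← hE4 S j (Finset.mem_univ j)]
      exact setIntegral_congr_fun (hEm S j) fun x hx => (hsub S j hx j).1 hj
    · rw [hdz S j hj]
      apply le_antisymm
      · rw [← hdz S j hj, ← hE4 S j (Finset.mem_univ j)]
        exact integral_mono (hi j).integrableOn hp.integrableOn (hle j)
      · exact integral_nonneg (h0 j)
  refine ⟨fun j => ⋃ S, E S j, fun j => MeasurableSet.iUnion fun S => hEm S j, ?_, ?_, ?_, ?_⟩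
  · intro j k hjk
    simp only [Set.disjoint_iUnion_left, Set.disjoint_iUnion_right]
    intro S S'
    by_cases hS : S = S'
    · subst hS; exact hE2 _ j (Finset.mem_univ _) k (Finset.mem_univ _) hjk
    · first
        | exact (hTd hS).mono (hsub _ _) (hsub _ _)
        | exact (hTd (Ne.symm hS)).mono (hsub _ _) (hsub _ _)
  · rw [Set.iUnion_comm, ← hTu]
    refine Set.iUnion_congr fun S => ?_
    rw [← hE3 S]; simp
  · intro j
    rw [integral_iUnion_fintype (fun S => hEm S j) (hEd j) (fun S => hp.integrableOn), ← hd1 j]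
    exact Finset.sum_congr rfl fun S _ => hE4 S j (Finset.mem_univ j)
  · intro j
    rw [integral_iUnion_fintype (fun S => hEm S j) (hEd j) (fun S => (hi j).integrableOn), ← hd1 j]
    exact Finset.sum_congr rfl fun S _ => hEh S j

open Filter Topology in
lemma aux_main {L : Type*} [MetricSpace L] [TopologicalSpace.SeparableSpace L]
    [MeasurableSpace L] [BorelSpace L]
    (N : ℕ) (hN : 1 ≤ N)
    (μ : Fin N → Measure L) (hfin : ∀ j, IsFiniteMeasure (μ j))
    (hatomless : ∀ j, NoAtoms (μ j)) (hne : ∀ j, μ j ≠ 0) :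
    ∃ E : Fin N → Set L,
      (∀ j, MeasurableSet (E j)) ∧
      (∀ j k : Fin N, j ≠ k → Disjoint (E j) (E k)) ∧
      ((⋃ j, E j) = Set.univ) ∧
      (∀ j k : Fin N, μ j (E k) ≤ μ j (E j)) ∧
      ¬ ∃ g : Fin N → L → ℝ,
          (∀ j, Measurable (g j)) ∧
          (∀ j x, g j x ∈ Set.Icc (0 : ℝ) 1) ∧
          (∀ x, ∑ j, g j x = 1) ∧
          (∀ j, ((μ j) (E j)).toReal < ∫ x, g j x ∂(μ j)) := by
  classical
  have hNpos : (0:ℝ) < N := by exact_mod_cast hN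
  let P : Set (Fin N → L → ℝ) := {g | (∀ j, Measurable (g j)) ∧
          (∀ j x, g j x ∈ Set.Icc (0 : ℝ) 1) ∧ (∀ x, ∑ j, g j x = 1)}
  let I : (Fin N → L → ℝ) → Fin N → ℝ := fun g j => ∫ x, g j x ∂(μ j)
  let U : Set (Fin N → ℝ) := I '' P
  have hint : ∀ g ∈ P, ∀ j k, Integrable (g j) (μ k) := fun g hg j k => by
    refine (integrable_const (1:ℝ)).mono' (hg.1 j).aestronglyMeasurable
      (Eventually.of_forall fun x => ?_)
    rw [Real.norm_eq_abs, abs_of_nonneg (hg.2.1 j x).1]; exact (hg.2.1 j x).2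
  have hUconv : Convex ℝ U := by
    rintro _ ⟨g, hg, rfl⟩ _ ⟨g', hg', rfl⟩ s t hs ht hst
    refine ⟨fun j x => s * g j x + t * g' j x, ⟨?_, ?_, ?_⟩, ?_⟩
    · intro j; exact ((hg.1 j).const_mul s).add ((hg'.1 j).const_mul t)
    · intro j x
      exact convex_Icc (0:ℝ) 1 (hg.2.1 j x) (hg'.2.1 j x) hs ht hst
    · intro x
      rw [Finset.sum_add_distrib, ← Finset.mul_sum, ← Finset.mul_sum, hg.2.2, hg'.2.2]; linarith
    · funext j
      simp only [I, Pi.add_apply, Pi.smul_apply, smul_eq_mul]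
      rw [integral_add ((hint g hg j j).const_mul s) ((hint g' hg' j j).const_mul t),
        integral_const_mul, integral_const_mul]
  have hUsub : U ⊆ Set.Icc 0 (fun j => (μ j).real Set.univ) := by
    rintro _ ⟨g, hg, rfl⟩
    refine ⟨fun j => integral_nonneg fun x => (hg.2.1 j x).1, fun j => ?_⟩
    have := integral_mono (hint g hg j j) (integrable_const (1:ℝ)) (fun x => (hg.2.1 j x).2)
    simpa [I] using this
  have hclsub : closure U ⊆ Set.Icc 0 (fun j => (μ j).real Set.univ) :=
    closure_minimal hUsub isClosed_Icc
  have hcomp : IsCompact (closure U) := isCompact_Icc.of_isClosed_subset isClosed_closure hclsub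
  have hmpos : ∀ j, 0 < (μ j).real Set.univ := fun j => by
    rw [measureReal_def]
    exact ENNReal.toReal_pos (by simpa using hne j) (measure_ne_top _ _)
  have hunif : (fun j => (μ j).real Set.univ * (N:ℝ)⁻¹) ∈ U := by
    refine ⟨fun _ _ => (N:ℝ)⁻¹, ⟨fun _ => measurable_const, fun _ _ => ⟨by positivity, ?_⟩, ?_⟩, ?_⟩
    · exact inv_le_one_of_one_le₀ (by exact_mod_cast hN)
    · intro x; simp [hNpos.ne']
    · funext j; simp [I]
  obtain ⟨u, huU, hmax⟩ := hcomp.exists_isMaxOn ⟨_, subset_closure hunif⟩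
    (f := fun v : Fin N → ℝ => ∏ j, v j) (by fun_prop)
  have hupos : ∀ j, 0 < u j := by
    have h1 : 0 < ∏ j, u j := lt_of_lt_of_le
      (Finset.prod_pos fun j _ => mul_pos (hmpos j) (inv_pos.2 hNpos)) (hmax (subset_closure hunif))
    intro j
    refine lt_of_le_of_ne ((hclsub huU).1 j) fun h => h1.ne' ?_
    exact Finset.prod_eq_zero (Finset.mem_univ j) h.symm
  have hfoc : ∀ v ∈ U, ∑ j, v j / u j ≤ N := fun v hv =>
    aux_foc (closure U) hUconv.closure u huU hupos (fun v hv => hmax hv) v (subset_closure hv)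
      (fun j => (hUsub hv).1 j)
  -- densities
  let ν : Measure L := ∑ j, μ j
  have hac : ∀ j, μ j ≪ ν := fun j => by
    refine Measure.absolutelyContinuous_of_le ?_
    exact Finset.single_le_sum (f := μ) (fun k _ => Measure.zero_le _) (Finset.mem_univ j)
  have hνfin : IsFiniteMeasure ν := by
    refine ⟨?_⟩
    simp only [ν, Measure.coe_finsetSum, Finset.sum_apply]
    exact ENNReal.sum_lt_top.2 fun j _ => measure_lt_top _ _
  have hna : ∀ j, NullSingletonClass (μ j) := hatomless
  obtain ⟨φ, a, b, hφ, hφi, hφb⟩ := aux_phi L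
  have hνφ : ∀ t, ν (φ ⁻¹' {t}) = 0 := by
    intro t
    have hss : (φ ⁻¹' {t}).Subsingleton := fun x hx y hy => hφi (hx.trans hy.symm)
    simp only [ν, Measure.coe_finsetSum, Finset.sum_apply]
    exact Finset.sum_eq_zero fun j _ => hss.measure_zero (μ j)
  let h : Fin N → L → ℝ := fun j x => ((μ j).rnDeriv ν x).toReal / u j
  have hm : ∀ j, Measurable (h j) := fun j =>
    (Measure.measurable_rnDeriv _ _).ennreal_toReal.div_const _
  have h0 : ∀ j x, 0 ≤ h j x := fun j x => div_nonneg ENNReal.toReal_nonneg (hupos j).le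
  have hi : ∀ j, Integrable (h j) ν := fun j => Measure.integrable_toReal_rnDeriv.div_const _
  have hgh : ∀ j (q : L → ℝ), ∫ x, q x * h j x ∂ν = (∫ x, q x ∂(μ j)) / u j := by
    intro j q
    rw [← integral_toReal_rnDeriv_mul (hac j), ← integral_div]
    refine integral_congr_ae (Eventually.of_forall fun x => ?_)
    simp only [h]; ring
  have hset : ∀ j (A : Set L), ∫ x in A, h j x ∂ν = (μ j).real A / u j := by
    intro j A
    rw [← Measure.setIntegral_toReal_rnDeriv (hac j), ← integral_div]
  have hneF : (Finset.univ : Finset (Fin N)).Nonempty := ⟨⟨0, hN⟩, Finset.mem_univ _⟩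
  let p : L → ℝ := fun x => Finset.univ.sup' hneF fun j => h j x
  have hle : ∀ j x, h j x ≤ p x := fun j x =>
    Finset.le_sup' (fun j => h j x) (Finset.mem_univ j)
  have hex : ∀ x, ∃ j, h j x = p x := fun x => by
    obtain ⟨j, -, hj⟩ := Finset.exists_mem_eq_sup' hneF fun j => h j x
    exact ⟨j, hj.symm⟩
  have hpm : Measurable p := by
    have := Finset.measurable_sup' hneF (f := h) (fun j _ => hm j)
    convert this using 1
    funext x; simp [p]
  have hp0 : ∀ x, 0 ≤ p x := fun x => (h0 ⟨0, hN⟩ x).trans (hle _ x)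
  have hp : Integrable p ν := by
    refine (integrable_finsetSum Finset.univ fun j _ => hi j).mono' hpm.aestronglyMeasurable
      (Eventually.of_forall fun x => ?_)
    rw [Real.norm_eq_abs, abs_of_nonneg (hp0 x)]
    obtain ⟨j, hj⟩ := hex x
    rw [← hj]
    exact Finset.single_le_sum (f := fun j => h j x) (fun k _ => h0 k x) (Finset.mem_univ j)
  have hpN : ∫ x, p x ∂ν ≤ N := by
    let s : Fin N → Set L := fun j => {x | h j x = p x}
    have hs : ∀ j, MeasurableSet (s j) := fun j => measurableSet_eq_fun (hm j) hpm
    let e : Fin N → L → ℝ := fun j => (s j).indicator 1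
    have he : ∀ j, Measurable (e j) := fun j => measurable_one.indicator (hs j)
    have he0 : ∀ j x, 0 ≤ e j x := fun j x => Set.indicator_nonneg (fun _ _ => zero_le_one) x
    let D : L → ℝ := fun x => ∑ j, e j x
    have heD : ∀ j x, e j x ≤ D x := fun j x =>
      Finset.single_le_sum (f := fun j => e j x) (fun k _ => he0 k x) (Finset.mem_univ j)
    have hD : ∀ x, 0 < D x := fun x => by
      obtain ⟨j, hj⟩ := hex x
      have : e j x = 1 := Set.indicator_of_mem (show x ∈ s j from hj) _
      linarith [heD j x]
    let g : Fin N → L → ℝ := fun j x => e j x / D x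
    have hgP : g ∈ P := by
      refine ⟨fun j => (he j).div (Finset.measurable_fun_sum _ fun k _ => he k), fun j x =>
        ⟨div_nonneg (he0 j x) (hD x).le, div_le_one_of_le₀ (heD j x) (hD x).le⟩, fun x => ?_⟩
      simp only [g]
      rw [← Finset.sum_div]
      exact div_self (hD x).ne'
    have h1 := hfoc _ ⟨g, hgP, rfl⟩
    refine le_trans (le_of_eq ?_) h1
    simp only [I, ← hgh]
    rw [← integral_finsetSum]
    · refine integral_congr_ae (Eventually.of_forall fun x => ?_)
      have : ∀ j, g j x * h j x = g j x * p x := fun j => by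
        by_cases hj : x ∈ s j
        · rw [show h j x = p x from hj]
        · have : e j x = 0 := Set.indicator_of_notMem hj _
          simp [g, this]
      simp only [this]
      rw [← Finset.sum_mul, hgP.2.2 x, one_mul]
    · intro j _
      refine (hi j).bdd_mul (c := 1) (hgP.1 j).aestronglyMeasurable (Eventually.of_forall fun x => ?_)
      rw [Real.norm_eq_abs, abs_of_nonneg (hgP.2.1 j x).1]; exact (hgP.2.1 j x).2
  obtain ⟨v, hvU, hv⟩ := mem_closure_iff_seq_limit.1 huU
  choose g hgP hgv using hvU
  obtain ⟨E, hE1, hE2, hE3, hE4, hE5⟩ := aux_equil ν φ hφ a b hφb hνφ hN h hm h0 hi p hp hpm hle hpN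
    g (fun n => (hgP n).1) (fun n => (hgP n).2.1) (fun n => (hgP n).2.2) (by
      intro j
      have h1 := (tendsto_pi_nhds.1 hv j).div_const (u j)
      rw [div_self (hupos j).ne'] at h1
      refine h1.congr fun n => ?_
      rw [hgh, ← hgv n])
  have hEu : ∀ j, (μ j).real (E j) = u j := fun j => by
    have := hE5 j
    rwa [hset, div_eq_one_iff_eq (hupos j).ne'] at this
  refine ⟨E, hE1, hE2, hE3, ?_, ?_⟩
  · intro j k
    rw [← ENNReal.toReal_le_toReal (measure_ne_top _ _) (measure_ne_top _ _)]
    change (μ j).real (E k) ≤ (μ j).real (E j)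
    rw [hEu]
    have h1 : ∫ x in E k, h j x ∂ν ≤ ∫ x in E k, p x ∂ν :=
      integral_mono (hi j).integrableOn hp.integrableOn (hle j)
    rw [hE4, hset, div_le_one (hupos j)] at h1
    exact h1
  · rintro ⟨g, hg1, hg2, hg3, hg4⟩
    have h1 := hfoc _ ⟨g, ⟨hg1, hg2, hg3⟩, rfl⟩
    have h2 : ∑ j : Fin N, (1:ℝ) < ∑ j, I g j / u j := by
      refine Finset.sum_lt_sum_of_nonempty hneF fun j _ => ?_
      rw [one_lt_div (hupos j), ← hEu j]
      exact hg4 j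
    simp at h2
    linarith

/-- Let `L` be a separable metric space with its Borel σ-algebra,
`N ≥ 1`, and `μ_1, …, μ_N` finite atomless Borel measures on `L` (agents' utilities).
There exists a measurable partition `(E_1, …, E_N)` of `L` that is (i) envy-free:
`μ_j(E_j) ≥ μ_j(E_k)` for all `j,k`; and (ii) weakly Pareto efficient: there is no
partition of unity `(g_1, …, g_N)` with `∫ g_j dμ_j > μ_j(E_j)` for every `j`. -/
theorem stmt16 {L : Type*} [MetricSpace L] [TopologicalSpace.SeparableSpace L]
    [MeasurableSpace L] [BorelSpace L]
    (N : ℕ) (hN : 1 ≤ N)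
    (μ : Fin N → Measure L) (hfin : ∀ j, IsFiniteMeasure (μ j))
    (hatomless : ∀ j, NoAtoms (μ j)) :
    ∃ E : Fin N → Set L,
      (∀ j, MeasurableSet (E j)) ∧
      (∀ j k : Fin N, j ≠ k → Disjoint (E j) (E k)) ∧
      ((⋃ j, E j) = Set.univ) ∧
      (∀ j k : Fin N, μ j (E k) ≤ μ j (E j)) ∧
      ¬ ∃ g : Fin N → L → ℝ,
          (∀ j, Measurable (g j)) ∧
          (∀ j x, g j x ∈ Set.Icc (0 : ℝ) 1) ∧
          (∀ x, ∑ j, g j x = 1) ∧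
          (∀ j, ((μ j) (E j)).toReal < ∫ x, g j x ∂(μ j)) := by
  classical
  by_cases hall : ∀ j, μ j = 0
  · refine ⟨fun j => if j = ⟨0, hN⟩ then Set.univ else ∅, ?_, ?_, ?_, ?_, ?_⟩
    · intro j; dsimp only; split_ifs <;> simp
    · intro j k hjk
      dsimp only
      split_ifs with h1 h2
      · exact absurd (h1.trans h2.symm) hjk
      all_goals simp
    · refine Set.eq_univ_of_forall fun x => Set.mem_iUnion.2 ⟨⟨0, hN⟩, by simp⟩
    · intro j k; simp [hall j]
    · rintro ⟨g, -, -, -, h⟩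
      have := h ⟨0, hN⟩
      simp [hall] at this
  · have hna : ∀ j, NullSingletonClass (μ j) := hatomless
    push Not at hall
    obtain ⟨i, hi⟩ := hall
    obtain ⟨E, h1, h2, h3, h4, h5⟩ := aux_main N hN (fun j => if μ j = 0 then μ i else μ j)
      (fun j => by split_ifs <;> solve_by_elim)
      (fun j => by split_ifs <;> solve_by_elim)
      (fun j => by split_ifs <;> assumption)
    refine ⟨E, h1, h2, h3, ?_, ?_⟩
    · intro j k
      by_cases hj : μ j = 0
      · simp [hj]
      · simpa [hj] using h4 j k
    · rintro ⟨g, hg1, hg2, hg3, hg4⟩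
      have hnz : ∀ j, μ j ≠ 0 := fun j hj => by
        have := hg4 j
        simp [hj] at this
      exact h5 ⟨g, hg1, hg2, hg3, fun j => by simpa [hnz j] using hg4 j⟩
end

section
/- There exists a partition of unity (f_1,…,f_N) in which every f_j is a measurable simple function (finite range, values in [0,1]) such that: (i) envy-freeness: ∫ f_j dμ_j ≥ ∫ f_k dμ_j for all j,k ∈ {1,…,N}; and (ii) weak Pareto efficiency: there is no partition of unity (g_1,…,g_N) with ∫ g_j dμ_j > ∫ f_j dμ_j for every j. -/
open MeasureTheory Filter Topology

lemma aux_le_sup {N : ℕ} (a : Fin N → ℝ) (j : Fin N) : a j ≤ ⨆ i, a i :=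
  le_ciSup (Set.finite_range a).bddAbove j

lemma aux_coercive (a : ℝ) (ha : 0 < a) : ∃ C : ℝ, ∀ s : ℝ, |s| - C ≤ a * Real.exp s - s := by
  refine ⟨2 * |Real.log (a / 2)|, fun s => ?_⟩
  have h1 : a * Real.exp s = 2 * Real.exp (s + Real.log (a / 2)) := by
    rw [Real.exp_add, Real.exp_log (by positivity)]; ring
  have h2 := Real.add_one_le_exp (s + Real.log (a / 2))
  have h3 := neg_abs_le (Real.log (a / 2))
  have h4 := abs_nonneg (Real.log (a / 2))
  rcases le_total 0 s with hs | hs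
  · rw [abs_of_nonneg hs, h1]; linarith
  · rw [abs_of_nonpos hs]
    have : 0 < a * Real.exp s := by positivity
    linarith

section core
variable {L : Type*} [MeasurableSpace L] {N : ℕ} [NeZero N] {ν : Measure L}
  {h : Fin N → L → ℝ}

lemma aux_sup_integrable (hm : ∀ j, Measurable (h j)) (hi : ∀ j, Integrable (h j) ν)
    (w : Fin N → ℝ) : Integrable (fun x => ⨆ j, w j * h j x) ν := by
  have hb : Integrable (fun x => ∑ j, |w j * h j x|) ν :=
    integrable_finsetSum _ fun j _ => ((hi j).const_mul (w j)).abs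
  refine hb.mono' ?_ ?_
  · exact (Measurable.iSup fun j => (hm j).const_mul (w j)).aestronglyMeasurable
  · refine Eventually.of_forall fun x => ?_
    obtain ⟨i, hi⟩ := exists_eq_ciSup_of_finite (f := fun j => w j * h j x)
    rw [← hi, Real.norm_eq_abs]
    exact Finset.single_le_sum (f := fun j => |w j * h j x|) (fun j _ => abs_nonneg _)
      (Finset.mem_univ i)

lemma aux_lip (hm : ∀ j, Measurable (h j)) (hi : ∀ j, Integrable (h j) ν)
    (h0 : ∀ j x, 0 ≤ h j x) (w w' : Fin N → ℝ) :
    ∫ x, (⨆ j, w j * h j x) ∂ν ≤ ∫ x, (⨆ j, w' j * h j x) ∂ν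
      + ∑ j, |w j - w' j| * ∫ x, h j x ∂ν := by
  have e : ∑ j, |w j - w' j| * ∫ x, h j x ∂ν = ∫ x, ∑ j, |w j - w' j| * h j x ∂ν := by
    rw [integral_finsetSum _ fun j _ => (hi j).const_mul _]
    simp_rw [integral_const_mul]
  have i2 : Integrable (fun x => ∑ j, |w j - w' j| * h j x) ν :=
    integrable_finsetSum _ fun j _ => (hi j).const_mul _
  rw [e, ← integral_add (aux_sup_integrable hm hi w') i2]
  refine integral_mono (aux_sup_integrable hm hi w) ((aux_sup_integrable hm hi w').add i2) ?_
  intro x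
  refine ciSup_le fun j => ?_
  have a1 := aux_le_sup (fun j => w' j * h j x) j
  have a2 := Finset.single_le_sum (f := fun j => |w j - w' j| * h j x)
    (fun j _ => mul_nonneg (abs_nonneg _) (h0 j x)) (Finset.mem_univ j)
  have a3 := mul_le_mul_of_nonneg_right (le_abs_self (w j - w' j)) (h0 j x)
  simp only at a1 a2 ⊢
  linarith

lemma aux_cont (hm : ∀ j, Measurable (h j)) (hi : ∀ j, Integrable (h j) ν)
    (h0 : ∀ j x, 0 ≤ h j x) :
    Continuous (fun w : Fin N → ℝ => ∫ x, (⨆ j, w j * h j x) ∂ν) := by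
  rw [continuous_iff_continuousAt]
  intro w
  unfold ContinuousAt
  rw [tendsto_iff_dist_tendsto_zero]
  have hlim : Tendsto (fun v : Fin N → ℝ => ∑ j, |v j - w j| * ∫ x, h j x ∂ν) (𝓝 w) (𝓝 0) := by
    have : Continuous (fun v : Fin N → ℝ => ∑ j, |v j - w j| * ∫ x, h j x ∂ν) := by fun_prop
    simpa using this.tendsto w
  refine squeeze_zero (fun _ => dist_nonneg) (fun v => ?_) hlim
  rw [Real.dist_eq, abs_le]
  have b1 := aux_lip hm hi h0 v w
  have b2 := aux_lip hm hi h0 w v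
  simp_rw [abs_sub_comm (w _)] at b2
  constructor <;> linarith

lemma aux_min (hm : ∀ j, Measurable (h j)) (hi : ∀ j, Integrable (h j) ν)
    (h0 : ∀ j x, 0 ≤ h j x) (hpos : ∀ j, 0 < ∫ x, h j x ∂ν) :
    ∃ w : Fin N → ℝ, (∀ j, 0 < w j) ∧ ∀ v : Fin N → ℝ, (∀ j, 0 < v j) →
      ∫ x, (⨆ j, w j * h j x) ∂ν - ∑ j, Real.log (w j) ≤
      ∫ x, (⨆ j, v j * h j x) ∂ν - ∑ j, Real.log (v j) := by
  have hN : (0 : ℝ) < N := by exact_mod_cast Nat.pos_of_ne_zero (NeZero.ne N)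
  let Ψ : (Fin N → ℝ) → ℝ := fun t =>
    ∫ x, (⨆ j, Real.exp (t j) * h j x) ∂ν - ∑ j, t j
  have hc : Continuous Ψ := by
    refine Continuous.sub ?_ (by fun_prop)
    exact (aux_cont hm hi h0).comp
      (continuous_pi fun j => Real.continuous_exp.comp (continuous_apply j))
  choose C hC using fun j => aux_coercive ((∫ x, h j x ∂ν) / N) (div_pos (hpos j) hN)
  have hlow : ∀ t, ‖t‖ - ∑ j, C j ≤ Ψ t := by
    intro t
    have h1 : ‖t‖ ≤ ∑ j, |t j| := by
      refine (pi_norm_le_iff_of_nonneg (Finset.sum_nonneg fun j _ => abs_nonneg _)).2 fun j => ?_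
      exact Finset.single_le_sum (f := fun j => |t j|) (fun j _ => abs_nonneg _) (Finset.mem_univ j)
    have h2 : ∑ j, (∫ x, h j x ∂ν) / N * Real.exp (t j) ≤
        ∫ x, (⨆ j, Real.exp (t j) * h j x) ∂ν := by
      have : ∀ j ∈ (Finset.univ : Finset (Fin N)), (∫ x, h j x ∂ν) / N * Real.exp (t j) ≤
          (∫ x, (⨆ j, Real.exp (t j) * h j x) ∂ν) / N := by
        intro j _
        rw [div_mul_eq_mul_div, mul_comm, ← integral_const_mul]
        gcongr
        · exact (hi j).const_mul _
        · exact aux_sup_integrable hm hi _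
        · exact fun x => aux_le_sup (fun j => Real.exp (t j) * h j x) j
      refine (Finset.sum_le_sum this).trans_eq ?_
      simp
      field_simp
    have h3 := Finset.sum_le_sum fun j (_ : j ∈ Finset.univ) => hC j (t j)
    simp only [Finset.sum_sub_distrib] at h3
    simp only [Ψ]
    linarith
  have ht : Tendsto Ψ (cocompact _) atTop := by
    refine tendsto_atTop_mono hlow ?_
    exact tendsto_atTop_add_const_right _ _ (tendsto_norm_cocompact_atTop)
  obtain ⟨t, ht⟩ := hc.exists_forall_le ht
  refine ⟨fun j => Real.exp (t j), fun j => Real.exp_pos _, fun v hv => ?_⟩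
  have := ht fun j => Real.log (v j)
  simpa [Ψ, Real.exp_log (hv _)] using this

/-- directional derivative inequality -/
lemma aux_dir (hm : ∀ j, Measurable (h j)) (hi : ∀ j, Integrable (h j) ν)
    (h0 : ∀ j x, 0 ≤ h j x) (w : Fin N → ℝ) (hw : ∀ j, 0 < w j)
    (hmin : ∀ v : Fin N → ℝ, (∀ j, 0 < v j) →
      ∫ x, (⨆ j, w j * h j x) ∂ν - ∑ j, Real.log (w j) ≤
      ∫ x, (⨆ j, v j * h j x) ∂ν - ∑ j, Real.log (v j))
    (d : Fin N → ℝ) (s : L → Fin N)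
    (hs1 : ∀ x k, w k * h k x ≤ w (s x) * h (s x) x)
    (hs2 : ∀ x k, w k * h k x = w (s x) * h (s x) x → d k ≤ d (s x)) :
    ∑ j, d j ≤ ∫ x, d (s x) * (w (s x) * h (s x) x) ∂ν := by
  have hp : ∀ x, (⨆ j, w j * h j x) = w (s x) * h (s x) x := fun x =>
    le_antisymm (ciSup_le fun k => hs1 x k) (aux_le_sup (fun j => w j * h j x) _)
  set D := ∑ j, |d j| with hD
  have hdD : ∀ j, |d j| ≤ D := fun j =>
    Finset.single_le_sum (f := fun j => |d j|) (fun j _ => abs_nonneg _) (Finset.mem_univ j)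
  let G : ℝ → L → ℝ := fun ε x =>
    ((⨆ j, (w j * (1 + ε * d j)) * h j x) - ⨆ j, w j * h j x) / ε
  have hlim : Tendsto (fun ε => ∫ x, G ε x ∂ν) (𝓝[>] 0)
      (𝓝 (∫ x, d (s x) * (w (s x) * h (s x) x) ∂ν)) := by
    refine tendsto_integral_filter_of_dominated_convergence
      (fun x => D * ⨆ j, w j * h j x) ?_ ?_ ((aux_sup_integrable hm hi w).const_mul D) ?_
    · refine Eventually.of_forall fun ε => Measurable.aestronglyMeasurable ?_
      exact ((Measurable.iSup fun j => (hm j).const_mul _).sub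
        (Measurable.iSup fun j => (hm j).const_mul _)).div_const _
    · filter_upwards [self_mem_nhdsWithin] with ε hε
      have hε : 0 < ε := hε
      refine Eventually.of_forall fun x => ?_
      rw [Real.norm_eq_abs, abs_div, abs_of_pos hε, div_le_iff₀ hε, abs_le]
      have hq : ∀ j, 0 ≤ w j * h j x := fun j => mul_nonneg (hw j).le (h0 j x)
      have hj : ∀ j, |ε * d j * (w j * h j x)| ≤ D * (w (s x) * h (s x) x) * ε := by
        intro j
        rw [abs_mul, abs_mul, abs_of_pos hε, abs_of_nonneg (hq j)]
        have := mul_le_mul (hdD j) (hs1 x j) (hq j) ((abs_nonneg _).trans (hdD j))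
        nlinarith
      rw [hp]
      constructor
      · have := aux_le_sup (fun j => (w j * (1 + ε * d j)) * h j x) (s x)
        have h2 := (abs_le.1 (hj (s x))).1
        nlinarith
      · rw [sub_le_iff_le_add]
        refine ciSup_le fun j => ?_
        have h2 := (abs_le.1 (hj j)).2
        have h3 := hs1 x j
        nlinarith
    · refine Eventually.of_forall fun x => ?_
      refine tendsto_const_nhds.congr' ?_
      have hk : ∀ k, ∀ᶠ ε : ℝ in 𝓝[>] 0,
          (w k * (1 + ε * d k)) * h k x ≤ (w (s x) * (1 + ε * d (s x))) * h (s x) x := by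
        intro k
        rcases eq_or_lt_of_le (hs1 x k) with he | hl
        · filter_upwards [self_mem_nhdsWithin] with ε hε
          have hε : 0 < ε := hε
          have h1 := hs2 x k he
          have h2 : 0 ≤ w (s x) * h (s x) x := mul_nonneg (hw _).le (h0 _ x)
          have h3 : (w k * (1 + ε * d k)) * h k x
            = (1 + ε * d k) * (w (s x) * h (s x) x) := by rw [← he]; ring
          have h4 : (w (s x) * (1 + ε * d (s x))) * h (s x) x
            = (1 + ε * d (s x)) * (w (s x) * h (s x) x) := by ring
          rw [h3, h4]
          gcongr
        · refine nhdsWithin_le_nhds ?_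
          have c1 : Continuous fun ε : ℝ => (w k * (1 + ε * d k)) * h k x := by fun_prop
          have c2 : Continuous fun ε : ℝ =>
            (w (s x) * (1 + ε * d (s x))) * h (s x) x := by fun_prop
          have := (c1.tendsto 0).eventually_lt (c2.tendsto 0) (by simpa using hl)
          exact this.mono fun _ h => h.le
      filter_upwards [eventually_all.2 hk, self_mem_nhdsWithin] with ε hε hε0
      have hε0 : 0 < ε := hε0
      have : (⨆ j, (w j * (1 + ε * d j)) * h j x)
          = (w (s x) * (1 + ε * d (s x))) * h (s x) x :=
        le_antisymm (ciSup_le fun k => hε k)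
          (aux_le_sup (fun j => (w j * (1 + ε * d j)) * h j x) _)
      simp only [G]
      rw [this, hp]
      field_simp
      ring
  have hlog : Tendsto (fun ε : ℝ => ∑ j, Real.log (1 + ε * d j) / ε) (𝓝[>] 0) (𝓝 (∑ j, d j)) := by
    refine tendsto_finsetSum _ fun j _ => ?_
    have hd : HasDerivAt (fun ε : ℝ => Real.log (1 + ε * d j)) (d j) 0 := by
      have := (((hasDerivAt_id (0:ℝ)).mul_const (d j)).const_add 1).log (by simp)
      simpa using this
    have := hd.tendsto_slope_zero_right
    refine this.congr fun ε => ?_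
    simp [div_eq_inv_mul]
  refine le_of_tendsto_of_tendsto hlog hlim ?_
  have hk : ∀ k, ∀ᶠ ε : ℝ in 𝓝[>] 0, 0 < 1 + ε * d k := by
    intro k
    refine nhdsWithin_le_nhds ?_
    have c1 : Continuous fun ε : ℝ => 1 + ε * d k := by fun_prop
    exact (c1.tendsto 0).eventually_const_lt (by simp)
  filter_upwards [eventually_all.2 hk, self_mem_nhdsWithin] with ε hε hε0
  have hε0 : 0 < ε := hε0
  have h1 := hmin (fun j => w j * (1 + ε * d j)) fun j => mul_pos (hw j) (hε j)
  simp_rw [Real.log_mul (hw _).ne' (hε _).ne', Finset.sum_add_distrib] at h1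
  simp only [G]
  rw [integral_div, ← Finset.sum_div,
    integral_sub (aux_sup_integrable hm hi _) (aux_sup_integrable hm hi _)]
  gcongr
  linarith

lemma aux_core (hm : ∀ j, Measurable (h j)) (hi : ∀ j, Integrable (h j) ν)
    (h0 : ∀ j x, 0 ≤ h j x) (hpos : ∀ j, 0 < ∫ x, h j x ∂ν) :
    ∃ (w : Fin N → ℝ) (f : Fin N → L → ℝ), (∀ j, 0 < w j) ∧
      (∀ j, Measurable (f j)) ∧
      (∀ j, (Set.range (f j)).Finite) ∧
      (∀ j x, f j x ∈ Set.Icc (0 : ℝ) 1) ∧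
      (∀ x, ∑ j, f j x = 1) ∧
      (∀ j x, f j x ≠ 0 → ∀ k, w k * h k x ≤ w j * h j x) ∧
      (∀ j, w j * ∫ x, h j x * f j x ∂ν = 1) := by
  classical
  obtain ⟨w, hw, hmin⟩ := aux_min hm hi h0 hpos
  let S : L → Finset (Fin N) := fun x =>
    Finset.univ.filter fun j => ∀ k, w k * h k x ≤ w j * h j x
  have hSne : ∀ x, (S x).Nonempty := by
    intro x
    obtain ⟨i, hi⟩ := exists_eq_ciSup_of_finite (f := fun j => w j * h j x)
    refine ⟨i, ?_⟩
    simp only [S, Finset.mem_filter, Finset.mem_univ, true_and]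
    intro k
    have := aux_le_sup (fun j => w j * h j x) k
    rw [← hi] at this
    exact this
  let : MeasurableSpace (Finset (Fin N)) := ⊤
  have hSm : Measurable S := by
    refine measurable_to_countable' fun T => ?_
    have : S ⁻¹' {T} = {x | ∀ j, (∀ k, w k * h k x ≤ w j * h j x) ↔ j ∈ T} := by
      ext x
      simp [S, Finset.ext_iff]
    rw [this]
    have e : ∀ j, MeasurableSet {x | ∀ k, w k * h k x ≤ w j * h j x} := by
      intro j
      rw [Set.ofPred_forall]
      exact MeasurableSet.iInter fun k =>
        measurableSet_le ((hm k).const_mul _) ((hm j).const_mul _)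
    rw [Set.ofPred_forall]
    refine MeasurableSet.iInter fun j => ?_
    by_cases hj : j ∈ T
    · simpa [hj] using e j
    · have h2 : {x | (∀ k, w k * h k x ≤ w j * h j x) ↔ j ∈ T}
          = {x | ∀ k, w k * h k x ≤ w j * h j x}ᶜ := by
        ext x
        simp [hj]
      rw [h2]
      exact (e j).compl
  have hcomp : ∀ g : Finset (Fin N) → ℝ, Measurable fun x => g (S x) := fun g =>
    (measurable_from_top (f := g)).comp hSm
  let Sel := {σ : Finset (Fin N) → Fin N // ∀ T, T.Nonempty → σ T ∈ T}
  let ind : Sel → Fin N → Finset (Fin N) → ℝ := fun σ j T => if σ.1 T = j then 1 else 0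
  have hInteg : ∀ (g : Finset (Fin N) → ℝ) j, Integrable (fun x => h j x * g (S x)) ν := by
    intro g j
    simp_rw [mul_comm (h j _)]
    refine (hi j).bdd_mul (c := ∑ T, |g T|) (hcomp g).aestronglyMeasurable ?_
    refine Eventually.of_forall fun x => ?_
    exact Finset.single_le_sum (f := fun T => |g T|) (fun j _ => abs_nonneg _)
      (Finset.mem_univ (S x))
  let v : Sel → Fin N → ℝ := fun σ j => w j * ∫ x, h j x * ind σ j (S x) ∂ν
  let A : (Sel → ℝ) →ₗ[ℝ] (Fin N → ℝ) := Fintype.linearCombination ℝ v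
  have key : (1 : Fin N → ℝ) ∈ A '' stdSimplex ℝ Sel := by
    by_contra hcon
    have hcv : Convex ℝ (A '' stdSimplex ℝ Sel) := (convex_stdSimplex ℝ Sel).linear_image A
    have hcl : IsClosed (A '' stdSimplex ℝ Sel) :=
      ((isCompact_stdSimplex ℝ Sel).image (LinearMap.continuous_of_finiteDimensional A)).isClosed
    obtain ⟨l, u, hl1, hl2⟩ := geometric_hahn_banach_closed_point hcv hcl hcon
    set d : Fin N → ℝ := fun i => l fun j => if i = j then 1 else 0 with hd
    have hl : ∀ y, l y = ∑ i, y i * d i := by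
      intro y
      have := LinearMap.pi_apply_eq_sum_univ (l : (Fin N → ℝ) →ₗ[ℝ] ℝ) y
      simpa using this
    have hsel : ∀ T : Finset (Fin N), ∃ i, T.Nonempty → i ∈ T ∧ ∀ k ∈ T, d k ≤ d i := by
      intro T
      by_cases hT : T.Nonempty
      · obtain ⟨i, h1, h2⟩ := T.exists_max_image d hT
        exact ⟨i, fun _ => ⟨h1, h2⟩⟩
      · exact ⟨0, fun h => absurd h hT⟩
    choose σ hσ using hsel
    let σ' : Sel := ⟨σ, fun T hT => (hσ T hT).1⟩
    have hv : l (v σ') < u := by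
      refine hl1 _ ⟨Pi.single σ' 1, single_mem_stdSimplex ℝ σ', ?_⟩
      simp [A, Fintype.linearCombination_apply_single]
    have hmem : ∀ x, ∀ k, w k * h k x ≤ w (σ (S x)) * h (σ (S x)) x := by
      intro x
      have := (hσ (S x) (hSne x)).1
      simpa [S] using this
    have hdir := aux_dir hm hi h0 w hw hmin d (fun x => σ (S x)) hmem (by
      intro x k hk
      refine (hσ (S x) (hSne x)).2 k ?_
      simp only [S, Finset.mem_filter, Finset.mem_univ, true_and]
      intro k'
      rw [hk]
      exact hmem x k')
    have e1 : l (v σ') = ∫ x, d (σ (S x)) * (w (σ (S x)) * h (σ (S x)) x) ∂ν := by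
      rw [hl]
      have : ∀ i, v σ' i * d i = ∫ x, (d i * w i) * (h i x * ind σ' i (S x)) ∂ν := by
        intro i
        rw [integral_const_mul]
        simp only [v]; ring
      simp_rw [this]
      rw [← integral_finsetSum _ fun i _ => (hInteg _ i).const_mul _]
      congr 1
      ext x
      simp [ind, σ', mul_assoc]
    have e2 : l 1 = ∑ j, d j := by simp [hl]
    linarith
  obtain ⟨c, ⟨hc0, hc1⟩, hc⟩ := key
  let F : Fin N → Finset (Fin N) → ℝ := fun j T => ∑ σ, c σ * ind σ j T
  have hF0 : ∀ j T, 0 ≤ F j T := fun j T => Finset.sum_nonneg fun σ _ =>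
    mul_nonneg (hc0 σ) (by simp only [ind]; split_ifs <;> norm_num)
  have hF1 : ∀ T, ∑ j, F j T = 1 := by
    intro T
    simp only [F]
    rw [Finset.sum_comm]
    simp [ind, hc1]
  refine ⟨w, fun j x => F j (S x), hw, fun j => hcomp _, fun j => ?_, fun j x => ⟨hF0 _ _, ?_⟩,
    fun x => hF1 _, fun j x hne => ?_, fun j => ?_⟩
  · exact (Set.finite_range (F j)).subset (Set.range_comp_subset_range S (F j))
  · rw [← hF1 (S x)]
    exact Finset.single_le_sum (f := fun j => F j (S x)) (fun j _ => hF0 _ _) (Finset.mem_univ j)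
  · obtain ⟨σ, -, hσ⟩ := Finset.exists_ne_zero_of_sum_ne_zero hne
    have hj : σ.1 (S x) = j := by
      by_contra hj
      simp [ind, hj] at hσ
    have := σ.2 (S x) (hSne x)
    rw [hj] at this
    simpa [S] using this
  · have h1 := congrFun hc j
    simp only [A, Fintype.linearCombination_apply, Finset.sum_apply, Pi.smul_apply, smul_eq_mul,
      Pi.one_apply, v] at h1
    rw [← h1]
    simp only [F, Finset.mul_sum]
    rw [integral_finsetSum]
    · rw [Finset.mul_sum]
      refine Finset.sum_congr rfl fun σ _ => ?_
      have h2 : ∫ x, h j x * (c σ * ind σ j (S x)) ∂ν = c σ * ∫ x, h j x * ind σ j (S x) ∂ν := by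
        rw [← integral_const_mul]
        refine integral_congr_ae (Eventually.of_forall fun x => ?_)
        simp only
        ring
      rw [h2]
      ring
    · intro σ _
      exact hInteg (fun T => c σ * ind σ j T) j

end core

/-- Let `L` be a separable metric space with its Borel σ-algebra,
`N ≥ 1`, and `μ_1, …, μ_N` finite Borel measures on `L` (not necessarily atomless).
There exists a partition of unity `(f_1, …, f_N)` consisting of measurable simple
functions (finite range, values in `[0,1]`) that is (i) envy-free:
`∫ f_j dμ_j ≥ ∫ f_k dμ_j` for all `j,k`; and (ii) weakly Pareto efficient: there is no
partition of unity `(g_1, …, g_N)` with `∫ g_j dμ_j > ∫ f_j dμ_j` for every `j`. -/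
theorem stmt17 {L : Type*} [MetricSpace L] [TopologicalSpace.SeparableSpace L]
    [MeasurableSpace L] [BorelSpace L]
    (N : ℕ) (hN : 1 ≤ N)
    (μ : Fin N → Measure L) (hfin : ∀ j, IsFiniteMeasure (μ j)) :
    ∃ f : Fin N → L → ℝ,
      (∀ j, Measurable (f j)) ∧
      (∀ j, (Set.range (f j)).Finite) ∧
      (∀ j x, f j x ∈ Set.Icc (0 : ℝ) 1) ∧
      (∀ x, ∑ j, f j x = 1) ∧
      (∀ j k : Fin N, ∫ x, f k x ∂(μ j) ≤ ∫ x, f j x ∂(μ j)) ∧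
      ¬ ∃ g : Fin N → L → ℝ,
          (∀ j, Measurable (g j)) ∧
          (∀ j x, g j x ∈ Set.Icc (0 : ℝ) 1) ∧
          (∀ x, ∑ j, g j x = 1) ∧
          (∀ j, ∫ x, f j x ∂(μ j) < ∫ x, g j x ∂(μ j)) := by
  have : NeZero N := ⟨by omega⟩
  by_cases hz : ∃ j, μ j = 0
  · obtain ⟨j₀, hj₀⟩ := hz
    have hN' : (1 : ℝ) ≤ N := by exact_mod_cast hN
    refine ⟨fun _ _ => (N : ℝ)⁻¹, fun _ => measurable_const, fun _ => ?_, fun _ _ => ?_, fun _ => ?_,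
      fun _ _ => le_rfl, ?_⟩
    · exact Set.finite_range_const
    · exact ⟨by positivity, inv_le_one_of_one_le₀ hN'⟩
    · have : (N : ℝ) ≠ 0 := by positivity
      simp [this]
    · rintro ⟨g, -, -, -, hg⟩
      have := hg j₀
      simp [hj₀] at this
  · push Not at hz
    let ν : Measure L := ∑ j, μ j
    let h : Fin N → L → ℝ := fun j x => ((μ j).rnDeriv ν x).toReal
    have hac : ∀ j, μ j ≪ ν := fun j =>
      Measure.absolutelyContinuous_of_le (Finset.single_le_sum (f := μ) (fun _ _ => Measure.zero_le _)
        (Finset.mem_univ j))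
    have hconv : ∀ j (g : L → ℝ), ∫ x, g x ∂(μ j) = ∫ x, h j x * g x ∂ν := fun j g =>
      (integral_rnDeriv_smul (hac j)).symm
    have hm : ∀ j, Measurable (h j) := fun j => (Measure.measurable_rnDeriv _ _).ennreal_toReal
    have hi : ∀ j, Integrable (h j) ν := fun j => Measure.integrable_toReal_rnDeriv
    have h0 : ∀ j x, 0 ≤ h j x := fun j x => ENNReal.toReal_nonneg
    have hpos : ∀ j, 0 < ∫ x, h j x ∂ν := by
      intro j
      have := hconv j (fun _ => 1)
      simp only [mul_one] at this
      rw [← this]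
      simp [Measure.real, ENNReal.toReal_pos_iff, hz j]
    obtain ⟨w, f, hw, hfm, hfr, hf01, hf1, hfs, hfw⟩ := aux_core hm hi h0 hpos
    have hgi : ∀ j (g : L → ℝ), Measurable g → (∀ x, g x ∈ Set.Icc (0 : ℝ) 1) →
        Integrable (fun x => h j x * g x) ν := by
      intro j g hg hg1
      simp_rw [mul_comm (h j _)]
      refine (hi j).bdd_mul (c := 1) hg.aestronglyMeasurable (Eventually.of_forall fun x => ?_)
      rw [Real.norm_eq_abs, abs_of_nonneg (hg1 x).1]
      exact (hg1 x).2
    refine ⟨f, hfm, hfr, hf01, hf1, fun j k => ?_, ?_⟩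
    · rw [hconv, hconv]
      have h1 : w j * ∫ x, h j x * f k x ∂ν ≤ w k * ∫ x, h k x * f k x ∂ν := by
        rw [← integral_const_mul, ← integral_const_mul]
        refine integral_mono ((hgi j _ (hfm k) (hf01 k)).const_mul _)
          ((hgi k _ (hfm k) (hf01 k)).const_mul _) fun x => ?_
        by_cases hx : f k x = 0
        · simp [hx]
        · have := mul_le_mul_of_nonneg_right (hfs k x hx j) (hf01 k x).1
          simpa only [mul_assoc] using this
      rw [hfw k, ← hfw j] at h1
      exact le_of_mul_le_mul_left h1 (hw j)
    · rintro ⟨g, hgm, hg01, hg1, hlt⟩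
      have h1 : ∑ j, w j * ∫ x, h j x * f j x ∂ν < ∑ j, w j * ∫ x, h j x * g j x ∂ν := by
        refine Finset.sum_lt_sum_of_nonempty Finset.univ_nonempty fun j _ => ?_
        have := hlt j
        rw [hconv, hconv] at this
        exact mul_lt_mul_of_pos_left this (hw j)
      have e : ∀ g : Fin N → L → ℝ, (∀ j, Measurable (g j)) →
          (∀ j x, g j x ∈ Set.Icc (0 : ℝ) 1) →
          ∑ j, w j * ∫ x, h j x * g j x ∂ν = ∫ x, ∑ j, w j * (h j x * g j x) ∂ν := by
        intro g hgm hg01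
        rw [integral_finsetSum _ fun j _ => (hgi j _ (hgm j) (hg01 j)).const_mul _]
        simp_rw [integral_const_mul]
      rw [e f hfm hf01, e g hgm hg01] at h1
      refine absurd h1 (not_lt.2 ?_)
      refine integral_mono
        (integrable_finsetSum _ fun j _ => (hgi j _ (hgm j) (hg01 j)).const_mul _)
        (integrable_finsetSum _ fun j _ => (hgi j _ (hfm j) (hf01 j)).const_mul _) fun x => ?_
      have hge : (⨆ j, w j * h j x) = ∑ j, w j * (h j x * f j x) := by
        rw [← mul_one (⨆ j, w j * h j x), ← hf1 x, Finset.mul_sum]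
        refine Finset.sum_congr rfl fun j _ => ?_
        by_cases hx : f j x = 0
        · simp [hx]
        · rw [le_antisymm (ciSup_le fun k => hfs j x hx k) (aux_le_sup (fun j => w j * h j x) j),
            mul_assoc]
      simp only
      rw [← hge, ← mul_one (⨆ j, w j * h j x), ← hg1 x, Finset.mul_sum]
      refine Finset.sum_le_sum fun j _ => ?_
      rw [← mul_assoc]
      exact mul_le_mul_of_nonneg_right (aux_le_sup (fun j => w j * h j x) j) (hg01 j x).1
end
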